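/- arXiv:1212.0322 — 3 statements merged into one kernel-verified Lean document; each statement's English description precedes it below -/
import Mathlib

section
/- For N ≥ 2 and any N×N complex matrices A, B, C, D, the average over the unitary group U(N) with respect to normalized Haar measure satisfies ⟨Tr(U*AUBU*CUD)⟩ = (1/(N²−1))·[Tr(A)Tr(C)Tr(BD) + Tr(AC)Tr(B)Tr(D)] − (1/(N(N²−1)))·[Tr(AC)Tr(BD) + Tr(A)Tr(B)Tr(C)Tr(D)]. -/
open MeasureTheory Matrix

noncomputable instance (m n α : Type*) [MeasurableSpace α] : MeasurableSpace (Matrix m n α) :=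
  (inferInstance : MeasurableSpace (m → n → α))

section ConjugationInvariant

variable {n : Type*} [Fintype n] [DecidableEq n]

/-- A bilinear form on matrices is invariant under simultaneous unitary conjugation. -/
def IsUnitaryConjInvariant (F : Matrix n n ℂ →ₗ[ℂ] Matrix n n ℂ →ₗ[ℂ] ℂ) : Prop :=
  ∀ S ∈ unitaryGroup n ℂ, ∀ A C, F (Sᴴ * A * S) (Sᴴ * C * S) = F A C

namespace IsUnitaryConjInvariant

variable {F : Matrix n n ℂ →ₗ[ℂ] Matrix n n ℂ →ₗ[ℂ] ℂ}

theorem phase_mul (hF : IsUnitaryConjInvariant F) (z : n → ℂ) (hz : ∀ i, star (z i) * z i = 1)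
    (i j k l : n) :
    star (z i) * z j * (star (z k) * z l) * F (single i j 1) (single k l 1) =
      F (single i j 1) (single k l 1) := by
  have hS : diagonal z ∈ unitaryGroup n ℂ := by
    rw [mem_unitaryGroup_iff', star_eq_conjTranspose, diagonal_conjTranspose, diagonal_mul_diagonal,
      ← diagonal_one]
    congr 1
    ext i
    exact hz i
  have hc (i j : n) : (diagonal z)ᴴ * single i j 1 * diagonal z =
      (star (z i) * z j) • single i j (1 : ℂ) := by
    ext a b
    rw [diagonal_conjTranspose, mul_diagonal, diagonal_mul, Matrix.smul_apply, single_apply]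
    by_cases h : i = a ∧ j = b
    · obtain ⟨rfl, rfl⟩ := h
      simp
    · simp [h]
  have h := hF _ hS (single i j 1) (single k l 1)
  rw [hc, hc] at h
  simp only [map_smul, LinearMap.smul_apply, smul_eq_mul] at h
  linear_combination h

theorem support (hF : IsUnitaryConjInvariant F) {i j k l : n}
    (h : F (single i j 1) (single k l 1) ≠ 0) : (i = j ∧ k = l) ∨ (i = l ∧ k = j) := by
  have key (p : n) := mul_right_cancel₀ h
    ((hF.phase_mul (fun m => if m = p then Complex.I else 1)
      (fun m => by split_ifs <;> simp) i j k l).trans (one_mul _).symm)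
  have hI : (-Complex.I : ℂ) ≠ 1 := fun h => by simpa using congrArg Complex.re h
  have hI' : (Complex.I : ℂ) ≠ 1 := fun h => by simpa using congrArg Complex.re h
  have hI2 : (-1 : ℂ) ≠ 1 := by norm_num
  have h1 := key i
  have h2 := key k
  by_cases a : i = j <;> by_cases b : i = k <;> by_cases c : i = l <;> by_cases d : k = l <;>
    by_cases e : k = j <;> subst_vars <;> simp_all [Ne.symm]

theorem perm (hF : IsUnitaryConjInvariant F) (σ : Equiv.Perm n) (i j k l : n) :
    F (single (σ i) (σ j) 1) (single (σ k) (σ l) 1) = F (single i j 1) (single k l 1) := by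
  have hS : σ.permMatrix ℂ ∈ unitaryGroup n ℂ := by
    rw [mem_unitaryGroup_iff', star_eq_conjTranspose, conjTranspose_permMatrix, ← permMatrix_mul]
    simp
  have hc (i j : n) : (σ.permMatrix ℂ)ᴴ * single i j (1 : ℂ) * σ.permMatrix ℂ =
      single (σ i) (σ j) 1 := by
    rw [conjTranspose_permMatrix, Equiv.Perm.permMatrix, Equiv.Perm.permMatrix,
      PEquiv.toMatrix_toPEquiv_mul, PEquiv.mul_toMatrix_toPEquiv, submatrix_submatrix]
    exact submatrix_single_equiv _ _ _ _ _
  have h := hF _ hS (single i j 1) (single k l 1)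
  rwa [hc, hc] at h

theorem diag_eq_add (hF : IsUnitaryConjInvariant F) {p q : n} (hpq : p ≠ q)
    (h1 : F (single q q 1) (single p p 1) = F (single p p 1) (single q q 1))
    (h2 : F (single q p 1) (single p q 1) = F (single p q 1) (single q p 1))
    (h3 : F (single q q 1) (single q q 1) = F (single p p 1) (single p p 1)) :
    F (single p p 1) (single p p 1) =
      F (single p p 1) (single q q 1) + F (single p q 1) (single q p 1) := by
  set S : Matrix n n ℂ := 1 - single p p (2 / 5) - single p q (4 / 5) - single q p (4 / 5)
    - single q q (8 / 5) with hSdef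
  have hSs : Sᴴ = S := by
    simp [hSdef, conjTranspose_single]
    abel
  have hS : S ∈ unitaryGroup n ℂ := by
    rw [mem_unitaryGroup_iff', star_eq_conjTranspose, hSs, hSdef]
    ext a b
    simp [sub_mul, mul_sub, single_mul_single_of_ne, hpq, hpq.symm, single_apply, one_apply]
    split_ifs <;> norm_num
  have hc : Sᴴ * single p p 1 * S = (9 / 25 : ℂ) • single p p (1 : ℂ)
      - (12 / 25 : ℂ) • single p q (1 : ℂ) - (12 / 25 : ℂ) • single q p (1 : ℂ)
      + (16 / 25 : ℂ) • single q q (1 : ℂ) := by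
    rw [hSs, hSdef]
    ext a b
    simp [sub_mul, mul_sub, single_mul_single_of_ne, hpq, hpq.symm, single_apply]
    split_ifs <;> norm_num
  have hz {i j k l : n} (h : ¬ ((i = j ∧ k = l) ∨ (i = l ∧ k = j))) :
      F (single i j 1) (single k l 1) = 0 := by
    by_contra h'
    exact h (hF.support h')
  have h := hF S hS (single p p 1) (single p p 1)
  rw [hc] at h
  simp only [map_sub, map_add, map_smul, LinearMap.sub_apply, LinearMap.add_apply,
    LinearMap.smul_apply, smul_eq_mul, h1, h2, h3] at h
  rw [@hz p p p q (by tauto), @hz p p q p (by tauto), @hz p q p p (by tauto),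
    @hz p q p q (by tauto), @hz p q q q (by tauto), @hz q p p p (by tauto),
    @hz q p q p (by tauto), @hz q p q q (by tauto), @hz q q p q (by tauto),
    @hz q q q p (by tauto)] at h
  linear_combination (-625 / 288 : ℂ) * h

theorem exists_eq (hF : IsUnitaryConjInvariant F) [Nontrivial n] :
    ∃ α β : ℂ, ∀ A C, F A C = α * (A.trace * C.trace) + β * (A * C).trace := by
  obtain ⟨p, q, hpq⟩ := exists_pair_ne n
  set α := F (single p p 1) (single q q 1)
  set β := F (single p q 1) (single q p 1)
  have hσ {i k : n} (h : i ≠ k) : ∃ σ : Equiv.Perm n, σ p = i ∧ σ q = k :=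
    MulAction.is_two_pretransitive_iff.mp
      (Equiv.Perm.isMultiplyPretransitive n 2) hpq h
  have ha {i k : n} (h : i ≠ k) : F (single i i 1) (single k k 1) = α := by
    obtain ⟨σ, rfl, rfl⟩ := hσ h
    exact hF.perm σ p p q q
  have hb {i k : n} (h : i ≠ k) : F (single i k 1) (single k i 1) = β := by
    obtain ⟨σ, rfl, rfl⟩ := hσ h
    exact hF.perm σ p q q p
  have hd (i : n) : F (single i i 1) (single i i 1) = α + β := by
    obtain ⟨k, hk⟩ := exists_ne i
    rw [← ha hk.symm, ← hb hk.symm]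
    refine hF.diag_eq_add hk.symm ?_ ?_ ?_
    · rw [ha hk, ha hk.symm]
    · rw [hb hk, hb hk.symm]
    · simpa using hF.perm (Equiv.swap i k) i i i i
  have hs (i j k l : n) : F (single i j 1) (single k l 1) =
      α * ((single i j (1 : ℂ)).trace * (single k l (1 : ℂ)).trace) +
        β * (single i j (1 : ℂ) * single k l (1 : ℂ)).trace := by
    have htr (i j : n) : (single i j (1 : ℂ)).trace = if i = j then 1 else 0 := by
      split_ifs with h
      · subst h; simp
      · simp [h]
    rw [trace_single_mul, htr, htr, single_apply]
    by_cases h : (i = j ∧ k = l) ∨ (i = l ∧ k = j)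
    · obtain ⟨rfl, rfl⟩ | ⟨rfl, rfl⟩ := h
      · by_cases hik : i = k
        · subst hik
          simp [hd]
        · simp [ha hik, Ne.symm hik]
      · by_cases hik : i = k
        · subst hik
          simp [hd]
        · simp [hb hik, hik]
    · rw [not_imp_comm.mp hF.support h]
      push Not at h
      have h1 : (if i = j then (1 : ℂ) else 0) * (if k = l then 1 else 0) = 0 := by
        by_cases hij : i = j <;> simp [hij, h.1]
      have h2 : ¬ (k = j ∧ l = i) := fun h' => h.2 h'.2.symm h'.1
      rw [h1, if_neg h2]
      simp
  refine ⟨α, β, fun A C => ?_⟩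
  have hsm (i j : n) (x : ℂ) : single i j x = x • single i j (1 : ℂ) := by simp
  induction A using Matrix.induction_on' with
  | h_zero => simp
  | h_add A A' hA hA' =>
    rw [map_add, LinearMap.add_apply, hA, hA', trace_add, add_mul A, trace_add]
    ring
  | h_std_basis i j x =>
    induction C using Matrix.induction_on' with
    | h_zero => simp
    | h_add C C' hC hC' =>
      rw [map_add, hC, hC', trace_add, mul_add _ C, trace_add]
      ring
    | h_std_basis k l y =>
      rw [hsm i j x, hsm k l y]
      simp only [map_smul, LinearMap.smul_apply, smul_mul_assoc, mul_smul_comm, trace_smul,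
        smul_eq_mul, hs]
      ring

end IsUnitaryConjInvariant

end ConjugationInvariant

section Moments

variable {n : Type*} {Ω : Type*} [MeasurableSpace Ω] {μ : Measure Ω}

/-- All entries of a random matrix are essentially bounded. -/
def EntriesEssBounded (μ : Measure Ω) (g : Ω → Matrix n n ℂ) : Prop :=
  ∀ i j, MemLp (fun ω => g ω i j) ⊤ μ

namespace EntriesEssBounded

variable {g h : Ω → Matrix n n ℂ}

theorem const [IsFiniteMeasure μ] (A : Matrix n n ℂ) : EntriesEssBounded μ fun _ => A :=
  fun _ _ => memLp_const _

theorem conjTranspose (hg : EntriesEssBounded μ g) : EntriesEssBounded μ fun ω => (g ω)ᴴ :=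
  fun i j => (hg j i).star

theorem mul [Fintype n] (hg : EntriesEssBounded μ g) (hh : EntriesEssBounded μ h) :
    EntriesEssBounded μ fun ω => g ω * h ω := fun i j => by
  simp only [mul_apply]
  exact memLp_finsetSum _ fun k _ => (hh k j).mul' (hg i k)

theorem integrable_trace [Fintype n] [IsFiniteMeasure μ] (hg : EntriesEssBounded μ g) :
    Integrable (fun ω => (g ω).trace) μ :=
  integrable_finsetSum _ fun i _ => (hg i i).integrable le_top

end EntriesEssBounded

theorem Matrix.measurable_apply (i j : n) : Measurable fun U : Matrix n n ℂ => U i j :=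
  (measurable_pi_apply j).comp (measurable_pi_apply i)

theorem Matrix.measurable_const_mul [Fintype n] (S : Matrix n n ℂ) :
    Measurable fun U : Matrix n n ℂ => S * U := by
  refine measurable_pi_lambda _ fun i => measurable_pi_lambda _ fun j => ?_
  simp only [mul_apply]
  exact Finset.measurable_sum _ fun k _ => (measurable_apply k j).const_mul _

variable [Fintype n] [DecidableEq n]

theorem sum_single_mul_mul_single (X : Matrix n n ℂ) :
    ∑ i, ∑ j, single i j 1 * X * single j i 1 = X.trace • (1 : Matrix n n ℂ) := by
  simp only [single_mul_mul_single, one_mul, mul_one]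
  rw [← sum_single_one, Finset.smul_sum]
  refine Finset.sum_congr rfl fun i _ => ?_
  ext a b
  by_cases h : i = a ∧ i = b <;> simp [Matrix.sum_apply, single_apply, trace, h]

theorem entriesEssBounded_of_ae_unitary {μ : Measure (Matrix n n ℂ)} [IsFiniteMeasure μ]
    (hmem : ∀ᵐ U ∂μ, U ∈ unitaryGroup n ℂ) : EntriesEssBounded μ fun U => U := fun i j =>
  memLp_top_of_bound (measurable_apply i j).aestronglyMeasurable 1
    (hmem.mono fun _ hU => entry_norm_bound_of_unitary hU i j)

theorem integrable_trace_fourth {μ : Measure (Matrix n n ℂ)} [IsFiniteMeasure μ]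
    (hmem : ∀ᵐ U ∂μ, U ∈ unitaryGroup n ℂ) (A B C D : Matrix n n ℂ) :
    Integrable (fun U => (Uᴴ * A * U * B * Uᴴ * C * U * D).trace) μ := by
  have hU := entriesEssBounded_of_ae_unitary hmem
  have hc := EntriesEssBounded.const (μ := μ) (n := n)
  exact (((((((hU.conjTranspose.mul (hc A)).mul hU).mul (hc B)).mul hU.conjTranspose).mul
    (hc C)).mul hU).mul (hc D)).integrable_trace

/-- The fourth moment `∫ Tr(U*AUBU*CUD)` as a bilinear form in `A` and `C`. -/
noncomputable def fourthMoment (μ : Measure (Matrix n n ℂ)) [IsFiniteMeasure μ]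
    (hmem : ∀ᵐ U ∂μ, U ∈ unitaryGroup n ℂ) (B D : Matrix n n ℂ) :
    Matrix n n ℂ →ₗ[ℂ] Matrix n n ℂ →ₗ[ℂ] ℂ :=
  LinearMap.mk₂ ℂ (fun A C => ∫ U, (Uᴴ * A * U * B * Uᴴ * C * U * D).trace ∂μ)
    (fun A A' C => by
      simp only [mul_add, add_mul, trace_add]
      exact integral_add (integrable_trace_fourth hmem _ _ _ _)
        (integrable_trace_fourth hmem _ _ _ _))
    (fun c A C => by
      simp only [mul_smul_comm, smul_mul_assoc, trace_smul]
      exact integral_smul _ _)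
    (fun A C C' => by
      simp only [mul_add, add_mul, trace_add]
      exact integral_add (integrable_trace_fourth hmem _ _ _ _)
        (integrable_trace_fourth hmem _ _ _ _))
    (fun c A C => by
      simp only [mul_smul_comm, smul_mul_assoc, trace_smul]
      exact integral_smul _ _)

theorem isUnitaryConjInvariant_fourthMoment {μ : Measure (Matrix n n ℂ)} [IsFiniteMeasure μ]
    (hmem : ∀ᵐ U ∂μ, U ∈ unitaryGroup n ℂ)
    (hinv : ∀ S ∈ unitaryGroup n ℂ, μ.map (fun U => S * U) = μ) (B D : Matrix n n ℂ) :
    IsUnitaryConjInvariant (fourthMoment μ hmem B D) := fun S hS A C => by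
  have hm := (integrable_trace_fourth hmem A B C D).aestronglyMeasurable
  rw [← hinv S hS] at hm
  have h := integral_map (measurable_const_mul S).aemeasurable hm
  rw [hinv S hS] at h
  rw [fourthMoment, LinearMap.mk₂_apply, LinearMap.mk₂_apply, h]
  simp only [conjTranspose_mul, Matrix.mul_assoc]

theorem fourthMoment_one_one {μ : Measure (Matrix n n ℂ)} [IsProbabilityMeasure μ]
    (hmem : ∀ᵐ U ∂μ, U ∈ unitaryGroup n ℂ) (B D : Matrix n n ℂ) :
    fourthMoment μ hmem B D 1 1 = (B * D).trace := by
  rw [fourthMoment, LinearMap.mk₂_apply]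
  calc _ = ∫ _, (B * D).trace ∂μ := integral_congr_ae (hmem.mono fun U hU => by
          have h : Uᴴ * U = 1 := mem_unitaryGroup_iff'.mp hU
          simp only [mul_one, h, one_mul, Matrix.mul_assoc _ Uᴴ U])
    _ = _ := by simp

theorem sum_fourthMoment_single {μ : Measure (Matrix n n ℂ)} [IsProbabilityMeasure μ]
    (hmem : ∀ᵐ U ∂μ, U ∈ unitaryGroup n ℂ) (B D : Matrix n n ℂ) :
    ∑ i, ∑ j, fourthMoment μ hmem B D (single i j 1) (single j i 1) = B.trace * D.trace := by
  simp only [fourthMoment, LinearMap.mk₂_apply]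
  have hint (i j : n) := integrable_trace_fourth hmem (single i j 1) B (single j i 1) D
  simp_rw [← integral_finsetSum Finset.univ fun j _ => hint _ j]
  rw [← integral_finsetSum _ fun i _ => integrable_finsetSum _ fun j _ => hint i j]
  calc _ = ∫ _, B.trace * D.trace ∂μ := integral_congr_ae (hmem.mono fun U hU => by
          have h : Uᴴ * U = 1 := mem_unitaryGroup_iff'.mp hU
          have h1 (i j : n) : Uᴴ * single i j 1 * U * B * Uᴴ * single j i 1 * U * D =
              Uᴴ * (single i j 1 * (U * B * Uᴴ) * single j i 1) * (U * D) := by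
            simp only [Matrix.mul_assoc]
          simp only [h1, ← trace_sum, ← Finset.sum_mul, ← Finset.mul_sum,
            sum_single_mul_mul_single]
          rw [mul_smul_comm, mul_one, smul_mul_assoc, trace_smul, ← Matrix.mul_assoc, h, one_mul,
            trace_mul_comm, ← Matrix.mul_assoc, h, one_mul, smul_eq_mul])
    _ = _ := by simp

end Moments

/-- For `N ≥ 2` and any `N×N` complex matrices `A, B, C, D`, the average over `U(N)` with
respect to normalized Haar measure satisfies
`⟨Tr(U*AUBU*CUD)⟩ = (1/(N²−1))·[Tr(A)Tr(C)Tr(BD) + Tr(AC)Tr(B)Tr(D)]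
  − (1/(N(N²−1)))·[Tr(AC)Tr(BD) + Tr(A)Tr(B)Tr(C)Tr(D)]`. -/
theorem unitary_fourth_moment (N : ℕ) (hN : 2 ≤ N) (A B C D : Matrix (Fin N) (Fin N) ℂ)
    (μ : Measure (Matrix (Fin N) (Fin N) ℂ)) [IsProbabilityMeasure μ]
    (hmem : ∀ᵐ U ∂μ, U ∈ Matrix.unitaryGroup (Fin N) ℂ)
    (hinv : ∀ S ∈ Matrix.unitaryGroup (Fin N) ℂ, μ.map (fun U => S * U) = μ) :
    ∫ U, (Uᴴ * A * U * B * Uᴴ * C * U * D).trace ∂μ =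
      (1 / ((N : ℂ) ^ 2 - 1)) *
        (A.trace * C.trace * (B * D).trace + (A * C).trace * B.trace * D.trace) -
      (1 / ((N : ℂ) * ((N : ℂ) ^ 2 - 1))) *
        ((A * C).trace * (B * D).trace + A.trace * B.trace * C.trace * D.trace) := by
  have : Nontrivial (Fin N) := Fin.nontrivial_iff_two_le.mpr hN
  obtain ⟨α, β, h⟩ := (isUnitaryConjInvariant_fourthMoment hmem hinv B D).exists_eq
  have h1 := fourthMoment_one_one hmem B D
  have h2 := sum_fourthMoment_single hmem B D
  simp only [h, trace_single_mul, mul_one, trace_one, Fintype.card_fin] at h1 h2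
  have h3 : α * N + β * N ^ 2 = B.trace * D.trace := by
    rw [← h2]
    have htr (i j : Fin N) : (single i j (1 : ℂ)).trace = if i = j then 1 else 0 := by
      split_ifs with h
      · subst h
        simp
      · simp [h]
    simp [htr, Finset.sum_add_distrib]
    ring
  have hN0 : (N : ℂ) ≠ 0 := by
    norm_cast
    omega
  have hN1 : (N : ℂ) ^ 2 - 1 ≠ 0 := by
    rw [sub_ne_zero]
    norm_cast
    nlinarith
  have hAC : ∫ U, (Uᴴ * A * U * B * Uᴴ * C * U * D).trace ∂μ =
      α * (A.trace * C.trace) + β * (A * C).trace := h A C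
  rw [hAC, ← h1]
  field_simp
  linear_combination (N * (A * C).trace - A.trace * C.trace) * h3
end

section
/- For N ≥ 2 and any N×N complex matrices A, B, C, D, the average over the unitary group U(N) with respect to normalized Haar measure satisfies ⟨Tr(U*AŪBUᵗCUD)⟩ = (1/(N²−1))·[Tr(ACᵗ)Tr(BDᵗ) + Tr(AC)Tr(B)Tr(D)] − (1/(N(N²−1)))·[Tr(AC)Tr(BDᵗ) + Tr(ACᵗ)Tr(B)Tr(D)]. -/
open MeasureTheory Matrix

lemma exists_perm_apply_eq_and_apply_eq {n : Type*} [DecidableEq n] {p q r s : n}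
    (hpq : p ≠ q) (hrs : r ≠ s) :
    ∃ σ : Equiv.Perm n, σ p = r ∧ σ q = s := by
  have hr : r ≠ Equiv.swap p r q := by
    intro e
    apply hpq
    have := congrArg (Equiv.swap p r) e
    simpa using this
  refine ⟨Equiv.swap (Equiv.swap p r q) s * Equiv.swap p r, ?_, by simp⟩
  simp [Equiv.swap_apply_of_ne_of_ne hr hrs]

/-- A four-index tensor is conjugation invariant if it is fixed by `S ⊗ S̄ ⊗ S ⊗ S̄` for every
unitary matrix `S`. -/
def ConjInvariant {n : Type*} [Fintype n] [DecidableEq n] (T : n → n → n → n → ℂ) : Prop :=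
  ∀ S ∈ Matrix.unitaryGroup n ℂ, ∀ i j k l, T i j k l =
    ∑ i', ∑ j', ∑ k', ∑ l', S i i' * star (S j j') * S k k' * star (S l l') * T i' j' k' l'

namespace ConjInvariant

variable {n : Type*} [Fintype n] [DecidableEq n] {T : n → n → n → n → ℂ}

lemma phase (h : ConjInvariant T) (s : n → ℂ) (hs : ∀ i, s i * star (s i) = 1) (i j k l : n) :
    T i j k l = s i * star (s j) * s k * star (s l) * T i j k l := by
  have hS : Matrix.diagonal s ∈ Matrix.unitaryGroup n ℂ := by
    rw [Matrix.mem_unitaryGroup_iff, Matrix.star_eq_conjTranspose, Matrix.diagonal_conjTranspose,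
      Matrix.diagonal_mul_diagonal, ← Matrix.diagonal_one]
    congr 1
    funext i
    exact hs i
  conv_lhs => rw [h _ hS i j k l]
  simp [Matrix.diagonal_apply, apply_ite, ite_mul]

lemma perm (h : ConjInvariant T) (σ : Equiv.Perm n) (i j k l : n) :
    T i j k l = T (σ i) (σ j) (σ k) (σ l) := by
  have hS : σ.permMatrix ℂ ∈ Matrix.unitaryGroup n ℂ := by
    rw [Matrix.mem_unitaryGroup_iff, Matrix.star_eq_conjTranspose, Matrix.conjTranspose_permMatrix,
      ← Matrix.permMatrix_mul]
    simp
  rw [h _ hS i j k l]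
  simp [Equiv.Perm.permMatrix, PEquiv.toMatrix_apply, apply_ite, ite_mul]

/-- The phase with value `I` at `m` and `1` elsewhere. -/
lemma phase_single (h : ConjInvariant T) (m i j k l : n) :
    T i j k l = (if i = m then Complex.I else 1) * (if j = m then -Complex.I else 1) *
      (if k = m then Complex.I else 1) * (if l = m then -Complex.I else 1) * T i j k l := by
  have := h.phase (fun x => if x = m then Complex.I else 1)
    (fun x => by split_ifs <;> simp) i j k l
  have hstar : ∀ x, star (if x = m then Complex.I else 1) = if x = m then -Complex.I else 1 :=
    fun x => by split_ifs <;> simp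
  simpa only [hstar] using this

lemma eq_zero (h : ConjInvariant T) {i j k l : n} (h₁ : ¬(i = l ∧ j = k)) (h₂ : ¬(i = j ∧ k = l)) :
    T i j k l = 0 := by
  have key : ∀ z w : ℂ, z = Complex.I * w → z = w → z = 0 := by
    intro z w hz hw
    subst hw
    have h0 : (1 - Complex.I) * z = 0 := by linear_combination hz
    rcases mul_eq_zero.1 h0 with h0 | h0
    · have := congrArg Complex.re h0
      simp at this
    · exact h0
  by_cases hij : i = j
  · subst hij
    have hkl : k ≠ l := fun e => h₂ ⟨rfl, e⟩
    have := h.phase_single k i i k l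
    refine key _ _ ?_ rfl
    by_cases hik : i = k <;> simp [hik, hkl.symm] at this <;> simpa [hik] using this
  · by_cases hil : i = l
    · subst hil
      have hjk : j ≠ k := fun e => h₁ ⟨rfl, e⟩
      have := h.phase_single k i j k i
      refine key _ _ ?_ rfl
      by_cases hik : i = k <;> simp [hik, hjk] at this <;> simpa [hik] using this
    · have := h.phase_single i i j k l
      simp only [if_true, if_neg (Ne.symm hij), if_neg (Ne.symm hil)] at this
      by_cases hki : k = i
      · simp only [if_pos hki] at this
        have hI := Complex.I_mul_I
        linear_combination (1 / 2) * this + (1 / 2) * T i j k l * hI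
      · simp only [if_neg hki, mul_one] at this
        exact key _ _ this rfl

/-- Invariance under the square root of a transposition. -/
lemma diag_eq (h : ConjInvariant T) {p q : n} (hpq : p ≠ q) :
    T p p p p = T p q q p + T p p q q := by
  set a : ℂ := (1 + Complex.I) / 2 with ha
  set b : ℂ := (1 - Complex.I) / 2 with hb
  have hsa : star a = b := by simp [ha, hb, sub_eq_add_neg]
  have hsb : star b = a := by simp [ha, hb]
  have hI := Complex.I_mul_I
  have hab : a * b = 1 / 2 := by rw [ha, hb]; linear_combination (-1 / 4) * hI
  have hsq : a * a + b * b = 0 := by rw [ha, hb]; linear_combination (1 / 2) * hI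
  set P : Matrix n n ℂ := (Equiv.swap p q).permMatrix ℂ with hP
  have hPP : P * P = 1 := by
    rw [hP, ← Matrix.permMatrix_mul]; simp
  have hPs : Pᴴ = P := by
    rw [hP, Matrix.conjTranspose_permMatrix]; simp
  have hS : a • (1 : Matrix n n ℂ) + b • P ∈ Matrix.unitaryGroup n ℂ := by
    rw [Matrix.mem_unitaryGroup_iff, Matrix.star_eq_conjTranspose, Matrix.conjTranspose_add,
      Matrix.conjTranspose_smul, Matrix.conjTranspose_smul, hPs, hsa, hsb]
    simp only [Matrix.conjTranspose_one, add_mul, mul_add, smul_mul_smul, hPP, one_mul, mul_one]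
    trans (2 * (a * b)) • 1 + (a * a + b * b) • P
    · module
    · rw [hsq, hab]; simp
  have hrow : ∀ x, (a • (1 : Matrix n n ℂ) + b • P) p x =
      (if x = p then a else 0) + (if x = q then b else 0) := by
    intro x
    simp [hP, Equiv.Perm.permMatrix, PEquiv.toMatrix_apply, Matrix.one_apply, eq_comm]
  have hrow' : ∀ x, star ((a • (1 : Matrix n n ℂ) + b • P) p x) =
      (if x = p then b else 0) + (if x = q then a else 0) := by
    intro x
    rw [hrow, star_add]
    simp [apply_ite star, hsa, hsb]
  have hT := h _ hS p p p p
  simp only [hrow'] at hT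
  simp only [hrow] at hT
  simp only [add_mul, mul_add, Finset.sum_add_distrib, ite_mul, mul_ite, zero_mul, mul_zero,
    Finset.sum_ite_eq', Finset.mem_univ, if_true] at hT
  have hz : ∀ {i j k l : n}, ¬(i = l ∧ j = k) → ¬(i = j ∧ k = l) → T i j k l = 0 := h.eq_zero
  have e₁ := h.perm (Equiv.swap p q) q q q q
  have e₂ := h.perm (Equiv.swap p q) q p p q
  have e₃ := h.perm (Equiv.swap p q) q q p p
  simp only [Equiv.swap_apply_left, Equiv.swap_apply_right] at e₁ e₂ e₃
  simp [hz, hpq, hpq.symm, e₁, e₂, e₃] at hT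
  have hab2 : a * b * (a * b) = 1 / 4 := by rw [hab]; norm_num
  linear_combination 2 * hT + 4 * (T p p p p + T p q q p + T p p q q) * hab2

lemma exists_coeff [Nontrivial n] (h : ConjInvariant T) : ∃ α β : ℂ, ∀ i j k l, T i j k l =
    (if i = l ∧ j = k then α else 0) + (if i = j ∧ k = l then β else 0) := by
  obtain ⟨p, q, hpq⟩ := exists_pair_ne n
  refine ⟨T p q q p, T p p q q, fun i j k l => ?_⟩
  have key : ∀ r s, r ≠ s → T r s s r = T p q q p ∧ T r r s s = T p p q q := by
    intro r s hrs
    obtain ⟨σ, rfl, rfl⟩ := exists_perm_apply_eq_and_apply_eq hpq hrs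
    exact ⟨(h.perm σ p q q p).symm, (h.perm σ p p q q).symm⟩
  by_cases h₁ : i = l ∧ j = k
  · obtain ⟨rfl, rfl⟩ := h₁
    by_cases hij : i = j
    · subst hij
      obtain ⟨s, hs⟩ := exists_ne i
      obtain ⟨e₁, e₂⟩ := key i s hs.symm
      simp [h.diag_eq hs.symm, e₁, e₂]
    · simp [hij, (key i j hij).1]
  · by_cases h₂ : i = j ∧ k = l
    · obtain ⟨rfl, rfl⟩ := h₂
      have hik : i ≠ k := fun e => h₁ ⟨e, e⟩
      simp [hik, (key i k hik).2]
    · simp [h₁, h₂, h.eq_zero h₁ h₂]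

end ConjInvariant

section Moments

variable {N : ℕ} {μ : Measure (Matrix (Fin N) (Fin N) ℂ)}

lemma memLp_top_entry [IsProbabilityMeasure μ]
    (hmem : ∀ᵐ U ∂μ, U ∈ Matrix.unitaryGroup (Fin N) ℂ) (i j : Fin N) :
    MemLp (fun U : Matrix (Fin N) (Fin N) ℂ => U i j) ⊤ μ := by
  have hm : Measurable (fun U : Matrix (Fin N) (Fin N) ℂ => U i j) :=
    (measurable_pi_apply j).comp (measurable_pi_apply i)
  refine memLp_top_of_bound hm.aestronglyMeasurable 1 ?_
  filter_upwards [hmem] with U hU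
  exact entry_norm_bound_of_unitary hU i j

lemma memLp_top_conj_entry [IsProbabilityMeasure μ]
    (hmem : ∀ᵐ U ∂μ, U ∈ Matrix.unitaryGroup (Fin N) ℂ)
    (B : Matrix (Fin N) (Fin N) ℂ) (i j : Fin N) :
    MemLp (fun U : Matrix (Fin N) (Fin N) ℂ => (U * B * Uᴴ) i j) ⊤ μ := by
  simp only [Matrix.mul_apply, Matrix.conjTranspose_apply]
  refine memLp_finsetSum _ fun k _ => ?_
  refine MemLp.mul (p := ⊤) (q := ⊤) (r := ⊤) (memLp_top_entry hmem j k).star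
    (memLp_finsetSum _ fun l _ => ?_)
  exact (memLp_top_entry hmem i l).mul_const _

lemma integrable_conj_entry_mul [IsProbabilityMeasure μ]
    (hmem : ∀ᵐ U ∂μ, U ∈ Matrix.unitaryGroup (Fin N) ℂ)
    (B D : Matrix (Fin N) (Fin N) ℂ) (i j k l : Fin N) :
    Integrable (fun U : Matrix (Fin N) (Fin N) ℂ => (U * B * Uᴴ) i j * (U * D * Uᴴ) k l) μ :=
  (MemLp.mul (p := ⊤) (q := ⊤) (r := ⊤) (memLp_top_conj_entry hmem D k l)
    (memLp_top_conj_entry hmem B i j)).integrable le_top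

lemma integral_sum_const_mul {Ω ι : Type*} [MeasurableSpace Ω] {ν : Measure Ω} [Fintype ι]
    (c : ι → ι → ι → ι → ℂ) {F : ι → ι → ι → ι → Ω → ℂ} (hF : ∀ i j k l, Integrable (F i j k l) ν) :
    ∫ ω, ∑ i, ∑ j, ∑ k, ∑ l, c i j k l * F i j k l ω ∂ν =
      ∑ i, ∑ j, ∑ k, ∑ l, c i j k l * ∫ ω, F i j k l ω ∂ν := by
  have hi : ∀ i j k l, Integrable (fun ω => c i j k l * F i j k l ω) ν :=
    fun i j k l => (hF i j k l).const_mul _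
  rw [integral_finsetSum _ fun i _ => integrable_finsetSum _ fun j _ =>
    integrable_finsetSum _ fun k _ => integrable_finsetSum _ fun l _ => hi i j k l]
  refine Finset.sum_congr rfl fun i _ => ?_
  rw [integral_finsetSum _ fun j _ =>
    integrable_finsetSum _ fun k _ => integrable_finsetSum _ fun l _ => hi i j k l]
  refine Finset.sum_congr rfl fun j _ => ?_
  rw [integral_finsetSum _ fun k _ => integrable_finsetSum _ fun l _ => hi i j k l]
  refine Finset.sum_congr rfl fun k _ => ?_
  rw [integral_finsetSum _ fun l _ => hi i j k l]
  exact Finset.sum_congr rfl fun l _ => integral_const_mul _ _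

lemma measurable_mul_left (S : Matrix (Fin N) (Fin N) ℂ) :
    Measurable (fun U : Matrix (Fin N) (Fin N) ℂ => S * U) := by
  refine measurable_pi_lambda _ fun i => measurable_pi_lambda _ fun j => ?_
  simp only [Matrix.mul_apply]
  refine Finset.measurable_sum _ fun k _ => Measurable.const_mul ?_ _
  exact (measurable_pi_apply j).comp (measurable_pi_apply k)

lemma conj_apply (S W : Matrix (Fin N) (Fin N) ℂ) (i j : Fin N) :
    (S * W * Sᴴ) i j = ∑ i', ∑ j', S i i' * star (S j j') * W i' j' := by
  simp only [Matrix.mul_apply, Matrix.conjTranspose_apply, Finset.sum_mul]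
  rw [Finset.sum_comm]
  exact Finset.sum_congr rfl fun _ _ => Finset.sum_congr rfl fun _ _ => by ring

lemma conjInvariant_integral [IsProbabilityMeasure μ]
    (hmem : ∀ᵐ U ∂μ, U ∈ Matrix.unitaryGroup (Fin N) ℂ)
    (hinv : ∀ S ∈ Matrix.unitaryGroup (Fin N) ℂ, μ.map (fun U => S * U) = μ)
    (B D : Matrix (Fin N) (Fin N) ℂ) :
    ConjInvariant fun i j k l : Fin N =>
      ∫ U : Matrix (Fin N) (Fin N) ℂ, (U * B * Uᴴ) i j * (U * D * Uᴴ) k l ∂μ := by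
  intro S hS i j k l
  have hint := integrable_conj_entry_mul hmem B D
  have hmap : ∫ U : Matrix (Fin N) (Fin N) ℂ, (U * B * Uᴴ) i j * (U * D * Uᴴ) k l ∂μ =
      ∫ U : Matrix (Fin N) (Fin N) ℂ,
        (S * U * B * (S * U)ᴴ) i j * (S * U * D * (S * U)ᴴ) k l ∂μ := by
    conv_lhs => rw [← hinv S hS]
    refine integral_map (measurable_mul_left S).aemeasurable ?_
    rw [hinv S hS]
    exact (hint i j k l).aestronglyMeasurable
  have hconj : ∀ U E : Matrix (Fin N) (Fin N) ℂ, S * U * E * (S * U)ᴴ = S * (U * E * Uᴴ) * Sᴴ := by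
    intro U E
    simp only [Matrix.conjTranspose_mul, Matrix.mul_assoc]
  have hexp : ∀ U : Matrix (Fin N) (Fin N) ℂ,
      (S * U * B * (S * U)ᴴ) i j * (S * U * D * (S * U)ᴴ) k l =
        ∑ i', ∑ j', ∑ k', ∑ l', S i i' * star (S j j') * S k k' * star (S l l') *
          ((U * B * Uᴴ) i' j' * (U * D * Uᴴ) k' l') := by
    intro U
    rw [hconj, hconj, conj_apply, conj_apply]
    simp only [Finset.sum_mul]
    simp only [Finset.mul_sum]
    refine Finset.sum_congr rfl fun _ _ => Finset.sum_congr rfl fun _ _ =>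
      Finset.sum_congr rfl fun _ _ => Finset.sum_congr rfl fun _ _ => by ring
  simp only [hmap, hexp]
  exact integral_sum_const_mul _ fun i' j' k' l' => hint i' j' k' l'

/-- The integrand as a linear combination of products of entries of two conjugates of `U`. -/
lemma trace_mixed_eq_sum (A B C D U : Matrix (Fin N) (Fin N) ℂ) :
    (Uᴴ * A * Uᴴᵀ * B * Uᵀ * C * U * D).trace =
      ∑ b, ∑ g, ∑ f, ∑ c, A b c * C f g * ((U * Bᵀ * Uᴴ) f c * (U * D * Uᴴ) g b) := by
  have h : (Uᴴ * A * Uᴴᵀ * B * Uᵀ * C * U * D).trace =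
      (A * (U * Bᵀ * Uᴴ)ᵀ * C * (U * D * Uᴴ)).trace := by
    simp only [Matrix.transpose_mul, Matrix.transpose_transpose, Matrix.mul_assoc]
    rw [Matrix.trace_mul_comm]
    simp only [Matrix.mul_assoc]
  rw [h]
  simp only [Matrix.trace, Matrix.diag_apply]
  refine Finset.sum_congr rfl fun b _ => ?_
  rw [Matrix.mul_apply]
  refine Finset.sum_congr rfl fun g _ => ?_
  rw [Matrix.mul_apply, Finset.sum_mul]
  refine Finset.sum_congr rfl fun f _ => ?_
  rw [Matrix.mul_apply, Finset.sum_mul, Finset.sum_mul]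
  refine Finset.sum_congr rfl fun c _ => ?_
  rw [Matrix.transpose_apply]
  ring

lemma sum_integral_diag [IsProbabilityMeasure μ]
    (hmem : ∀ᵐ U ∂μ, U ∈ Matrix.unitaryGroup (Fin N) ℂ) (B D : Matrix (Fin N) (Fin N) ℂ) :
    ∑ i, ∑ k, ∫ U : Matrix (Fin N) (Fin N) ℂ, (U * B * Uᴴ) i i * (U * D * Uᴴ) k k ∂μ =
      B.trace * D.trace := by
  have hint := integrable_conj_entry_mul hmem B D
  simp only [← integral_finsetSum _ fun k _ => hint _ _ k k]
  rw [← integral_finsetSum _ fun i _ => integrable_finsetSum _ fun k _ => hint i i k k]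
  rw [integral_congr_ae (g := fun _ => B.trace * D.trace), integral_const]
  · simp
  filter_upwards [hmem] with U hU
  have hU' : Uᴴ * U = 1 := Matrix.mem_unitaryGroup_iff'.1 hU
  have htr : ∀ E : Matrix (Fin N) (Fin N) ℂ, (U * E * Uᴴ).trace = E.trace := fun E => by
    rw [Matrix.trace_mul_comm, ← Matrix.mul_assoc, hU', Matrix.one_mul]
  rw [← htr B, ← htr D]
  exact (Finset.sum_mul_sum _ _ _ _).symm

lemma sum_integral_antidiag [IsProbabilityMeasure μ]
    (hmem : ∀ᵐ U ∂μ, U ∈ Matrix.unitaryGroup (Fin N) ℂ) (B D : Matrix (Fin N) (Fin N) ℂ) :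
    ∑ i, ∑ k, ∫ U : Matrix (Fin N) (Fin N) ℂ, (U * B * Uᴴ) i k * (U * D * Uᴴ) k i ∂μ =
      (B * D).trace := by
  have hint := integrable_conj_entry_mul hmem B D
  simp only [← integral_finsetSum _ fun k _ => hint _ k k _]
  rw [← integral_finsetSum _ fun i _ => integrable_finsetSum _ fun k _ => hint i k k i]
  rw [integral_congr_ae (g := fun _ => (B * D).trace), integral_const]
  · simp
  filter_upwards [hmem] with U hU
  have hU' : Uᴴ * U = 1 := Matrix.mem_unitaryGroup_iff'.1 hU
  have hmul : U * B * Uᴴ * (U * D * Uᴴ) = U * (B * D) * Uᴴ := by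
    calc U * B * Uᴴ * (U * D * Uᴴ) = U * B * (Uᴴ * U) * D * Uᴴ := by simp only [Matrix.mul_assoc]
      _ = U * (B * D) * Uᴴ := by rw [hU', Matrix.mul_one, Matrix.mul_assoc U]
  have htr : (U * B * Uᴴ * (U * D * Uᴴ)).trace = (B * D).trace := by
    rw [hmul, Matrix.trace_mul_comm, ← Matrix.mul_assoc, hU', Matrix.one_mul]
  rw [← htr]
  simp only [Matrix.trace, Matrix.diag_apply, Matrix.mul_apply (M := U * B * Uᴴ)]

end Moments

/-- For `N ≥ 2` and any `N×N` complex matrices `A, B, C, D`, the average over `U(N)` with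
respect to normalized Haar measure satisfies
`⟨Tr(U*AŪBUᵗCUD)⟩ = (1/(N²−1))·[Tr(ACᵗ)Tr(BDᵗ) + Tr(AC)Tr(B)Tr(D)]
  − (1/(N(N²−1)))·[Tr(AC)Tr(BDᵗ) + Tr(ACᵗ)Tr(B)Tr(D)]`.
Here `Ū = Uᴴᵀ` is the entrywise complex conjugate. -/
theorem unitary_fourth_moment_mixed' (N : ℕ) (hN : 2 ≤ N) (A B C D : Matrix (Fin N) (Fin N) ℂ)
    (μ : Measure (Matrix (Fin N) (Fin N) ℂ)) [IsProbabilityMeasure μ]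
    (hmem : ∀ᵐ U ∂μ, U ∈ Matrix.unitaryGroup (Fin N) ℂ)
    (hinv : ∀ S ∈ Matrix.unitaryGroup (Fin N) ℂ, μ.map (fun U => S * U) = μ) :
    ∫ U, (Uᴴ * A * Uᴴᵀ * B * Uᵀ * C * U * D).trace ∂μ =
      (1 / ((N : ℂ) ^ 2 - 1)) *
        ((A * Cᵀ).trace * (B * Dᵀ).trace + (A * C).trace * B.trace * D.trace) -
      (1 / ((N : ℂ) * ((N : ℂ) ^ 2 - 1))) *
        ((A * C).trace * (B * Dᵀ).trace + (A * Cᵀ).trace * B.trace * D.trace) := by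
  have : Nontrivial (Fin N) := Fin.nontrivial_iff_two_le.2 hN
  have hint := integrable_conj_entry_mul hmem Bᵀ D
  obtain ⟨α, β, hT⟩ := (conjInvariant_integral hmem hinv Bᵀ D).exists_coeff
  have h₁ : (N : ℂ) * α + (N : ℂ) ^ 2 * β = B.trace * D.trace := by
    rw [← Matrix.trace_transpose B, ← sum_integral_diag hmem]
    simp only [hT]
    simp [Finset.sum_add_distrib]
    ring
  have h₂ : (N : ℂ) ^ 2 * α + (N : ℂ) * β = (B * Dᵀ).trace := by
    have hBD : (B * Dᵀ).trace = (Bᵀ * D).trace := by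
      rw [← Matrix.trace_transpose, Matrix.transpose_mul, Matrix.transpose_transpose,
        Matrix.trace_mul_comm]
    rw [hBD, ← sum_integral_antidiag hmem]
    simp only [hT]
    simp [ite_and, Finset.sum_add_distrib]
    ring
  have h₃ : ∫ U, (Uᴴ * A * Uᴴᵀ * B * Uᵀ * C * U * D).trace ∂μ =
      α * (A * Cᵀ).trace + β * (A * C).trace := by
    simp only [trace_mixed_eq_sum]
    rw [integral_sum_const_mul (fun b g f c => A b c * C f g) fun b g f c => hint f c g b]
    simp only [hT, ite_and, mul_add, mul_ite, mul_zero, Finset.sum_add_distrib]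
    simp only [Matrix.trace, Matrix.diag_apply, Matrix.mul_apply, Matrix.transpose_apply,
      Finset.mul_sum]
    simp
    simp only [mul_comm]
  have hN0 : (N : ℂ) ≠ 0 := Nat.cast_ne_zero.2 (by omega)
  have hN1 : (N : ℂ) ^ 2 - 1 ≠ 0 := by
    intro h
    have h' : (N : ℂ) ^ 2 = 1 := sub_eq_zero.1 h
    have h'' : N ^ 2 = 1 := by exact_mod_cast h'
    nlinarith
  rw [h₃, ← h₂, mul_assoc _ B.trace, mul_assoc _ B.trace, ← h₁]
  field_simp
  ring
end

section
/- For N ≥ 2 and any 2N×2N complex matrices A, B, C, D, the average over the compact symplectic group SP(2N) with respect to normalized Haar measure satisfies: ⟨Tr(U*AUBU*CUD)⟩ = (1/(4N(N−1)(2N+1)))·[(2N−1)Tr(A)Tr(C)Tr(BD) + Tr(A)Tr(C)Tr(I*BᵗID) − Tr(A)Tr(C)Tr(B)Tr(D) − Tr(I*AᵗIC)Tr(BD) + Tr(I*AᵗIC)Tr(B)Tr(D) − Tr(AC)Tr(BD) − (2N−1)Tr(I*AᵗIC)Tr(I*BᵗID) − Tr(AC)Tr(I*BᵗID) + (2N−1)Tr(AC)Tr(B)Tr(D)].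 -/
open MeasureTheory Matrix

/-- The `2N×2N` matrix `I` with `N×N` blocks `(0, -1; 1, 0)`. -/
def Imat (N : ℕ) : Matrix (Fin N ⊕ Fin N) (Fin N ⊕ Fin N) ℂ :=
  Matrix.fromBlocks 0 (-1) 1 0

/-- Membership in the compact symplectic group `SP(2N)`. -/
def IsCompactSymplectic {N : ℕ} (S : Matrix (Fin N ⊕ Fin N) (Fin N ⊕ Fin N) ℂ) : Prop :=
  Sᴴ * S = 1 ∧ Sᵀ * Imat N * S = Imat N

section Imat

variable (N : ℕ)

lemma Imat_mul_self : Imat N * Imat N = -1 := by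
  simp [Imat, Matrix.fromBlocks_multiply, ← Matrix.fromBlocks_one, Matrix.fromBlocks_neg]

lemma Imat_transpose : (Imat N)ᵀ = -Imat N := by
  simp [Imat, Matrix.fromBlocks_transpose, Matrix.fromBlocks_neg]

lemma Imat_conjTranspose : (Imat N)ᴴ = -Imat N := by
  simp [Imat, Matrix.fromBlocks_conjTranspose, Matrix.fromBlocks_neg]

lemma Imat_apply_swap (i j : Fin N ⊕ Fin N) : Imat N i j = -Imat N j i :=
  congr_fun₂ (Imat_transpose N) j i

lemma Imat_isUnit : IsUnit (Imat N) :=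
  IsUnit.of_mul_eq_one (-Imat N) (by simp [Imat_mul_self])

lemma Imat_inv : (Imat N)⁻¹ = -Imat N :=
  Matrix.inv_eq_right_inv (by simp [Imat_mul_self])

lemma sum_Imat_mul_Imat (i j : Fin N ⊕ Fin N) :
    ∑ q, Imat N i q * Imat N q j = -(1 : Matrix (Fin N ⊕ Fin N) (Fin N ⊕ Fin N) ℂ) i j :=
  congr_fun₂ (Imat_mul_self N) i j

lemma sum_sum_Imat_mul_Imat :
    ∑ i, ∑ q, Imat N i q * Imat N q i = -(2 * (N : ℂ)) := by
  simp_rw [sum_Imat_mul_Imat]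
  simp
  ring

lemma sum_sum_Imat_left (f : Fin N ⊕ Fin N → ℂ) (p : Fin N ⊕ Fin N) :
    ∑ i, ∑ q, Imat N i q * (Imat N p i * f q) = -f p := by
  rw [Finset.sum_comm]
  have h : ∀ q, ∑ i, Imat N i q * (Imat N p i * f q)
      = (∑ i, Imat N p i * Imat N i q) * f q := fun q => by
    rw [Finset.sum_mul]
    exact Finset.sum_congr rfl fun i _ => by ring
  simp_rw [h, sum_Imat_mul_Imat]
  simp [Matrix.one_apply]

lemma sum_sum_Imat_right (f : Fin N ⊕ Fin N → ℂ) (j : Fin N ⊕ Fin N) :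
    ∑ i, ∑ q, Imat N i q * (Imat N q j * f i) = -f j := by
  have h : ∀ i, ∑ q, Imat N i q * (Imat N q j * f i)
      = (∑ q, Imat N i q * Imat N q j) * f i := fun i => by
    rw [Finset.sum_mul]
    exact Finset.sum_congr rfl fun i _ => by ring
  simp_rw [h, sum_Imat_mul_Imat]
  simp [Matrix.one_apply]

end Imat

section Exponential

variable {N : ℕ} {X : Matrix (Fin N ⊕ Fin N) (Fin N ⊕ Fin N) ℂ}

lemma isCompactSymplectic_exp (h1 : Xᴴ = -X) (h2 : Xᵀ * Imat N = -(Imat N * X)) :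
    IsCompactSymplectic (NormedSpace.exp X) := by
  have hinv : NormedSpace.exp (-X) * NormedSpace.exp X = 1 := by
    rw [Matrix.exp_neg]
    exact Matrix.nonsing_inv_mul _ ((Matrix.isUnit_iff_isUnit_det _).1 (Matrix.isUnit_exp _))
  constructor
  · rw [← Matrix.exp_conjTranspose, h1, hinv]
  · have h3 : Xᵀ = Imat N * (-X) * (Imat N)⁻¹ := by
      have := congrArg (· * Imat N) h2
      simp only [Matrix.mul_assoc, Imat_mul_self, Matrix.neg_mul, Matrix.mul_neg,
        Matrix.mul_one, neg_inj] at this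
      rw [this, Imat_inv]
      simp only [Matrix.mul_assoc, Matrix.neg_mul, Matrix.mul_neg, neg_neg]
    rw [← Matrix.exp_transpose, h3, Matrix.exp_conj _ _ (Imat_isUnit N), Imat_inv]
    rw [Matrix.mul_assoc, Matrix.mul_assoc, ← Matrix.mul_assoc (-Imat N), Matrix.neg_mul,
      Imat_mul_self, neg_neg, Matrix.one_mul, Matrix.mul_assoc, hinv, Matrix.mul_one]

lemma hasDerivAt_exp_smul_apply (i j : Fin N ⊕ Fin N) :
    HasDerivAt (fun t : ℝ => NormedSpace.exp (t • X) i j) (X i j) 0 := by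
  let _ : NormedRing (Matrix (Fin N ⊕ Fin N) (Fin N ⊕ Fin N) ℂ) := Matrix.linftyOpNormedRing
  let _ : NormedAlgebra ℝ (Matrix (Fin N ⊕ Fin N) (Fin N ⊕ Fin N) ℂ) :=
    Matrix.linftyOpNormedAlgebra
  have h := hasDerivAt_exp_smul_const X (0 : ℝ)
  rw [zero_smul, NormedSpace.exp_zero, one_mul] at h
  exact ((Matrix.entryLinearMap ℝ ℂ i j).toContinuousLinearMap.hasFDerivAt.comp_hasDerivAt 0 h)

end Exponential

section Lie

variable {N : ℕ}

lemma lie_invariance_four (τ : Fin N ⊕ Fin N → Fin N ⊕ Fin N → Fin N ⊕ Fin N → Fin N ⊕ Fin N → ℂ)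
    (hτ : ∀ S : Matrix (Fin N ⊕ Fin N) (Fin N ⊕ Fin N) ℂ, IsCompactSymplectic S → ∀ i j k l,
      ∑ a, ∑ b, ∑ c, ∑ d, S a i * S b j * S c k * S d l * τ a b c d = τ i j k l)
    (X : Matrix (Fin N ⊕ Fin N) (Fin N ⊕ Fin N) ℂ)
    (hX : Xᵀ * Imat N = -(Imat N * X)) (i j k l : Fin N ⊕ Fin N) :
    ∑ a, (X a i * τ a j k l + X a j * τ i a k l + X a k * τ i j a l + X a l * τ i j k a) = 0 := by
  have key : ∀ X : Matrix (Fin N ⊕ Fin N) (Fin N ⊕ Fin N) ℂ, Xᴴ = -X →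
      Xᵀ * Imat N = -(Imat N * X) →
      ∑ a, (X a i * τ a j k l + X a j * τ i a k l + X a k * τ i j a l + X a l * τ i j k a) = 0 := by
    intro X h1 h2
    have hd := fun a b => hasDerivAt_exp_smul_apply (X := X) a b
    have hsum : HasDerivAt (fun t : ℝ => ∑ a, ∑ b, ∑ c, ∑ d,
        NormedSpace.exp (t • X) a i * NormedSpace.exp (t • X) b j * NormedSpace.exp (t • X) c k
          * NormedSpace.exp (t • X) d l * τ a b c d) _ 0 :=
      HasDerivAt.fun_sum fun a _ => HasDerivAt.fun_sum fun b _ => HasDerivAt.fun_sum fun c _ =>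
        HasDerivAt.fun_sum fun d _ =>
          (((((hd a i).mul (hd b j)).mul (hd c k)).mul (hd d l)).mul_const (τ a b c d))
    have hmem : ∀ t : ℝ, IsCompactSymplectic (NormedSpace.exp (t • X)) := fun t =>
      isCompactSymplectic_exp (by simp [h1]) (by simp [h2])
    simp_rw [hτ _ (hmem _)] at hsum
    have h0 := hsum.unique (hasDerivAt_const (0 : ℝ) (τ i j k l))
    rw [← h0]
    simp [Matrix.one_apply, add_mul, Finset.sum_add_distrib]
  set Y : Matrix (Fin N ⊕ Fin N) (Fin N ⊕ Fin N) ℂ := X - Xᴴ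
  set Z : Matrix (Fin N ⊕ Fin N) (Fin N ⊕ Fin N) ℂ := Complex.I • (X + Xᴴ)
  have hX' : Xᴴᵀ * Imat N = -(Imat N * Xᴴ) := by
    have h := congrArg (fun M => (Imat N * Mᴴ * Imat N)) hX
    simp only [Matrix.conjTranspose_mul, Matrix.conjTranspose_neg, Imat_conjTranspose,
      Matrix.neg_mul, Matrix.mul_neg, neg_neg] at h
    rw [← Matrix.mul_assoc, Imat_mul_self] at h
    simp only [Matrix.mul_assoc, Imat_mul_self] at h
    rw [show Xᴴᵀ = Xᵀᴴ from rfl]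
    simpa using h
  have hY := key Y (by simp [Y]) (by
    simp only [Y, Matrix.transpose_sub, Matrix.sub_mul, Matrix.mul_sub, hX, hX']; abel)
  have hZ := key Z (by simp [Z, add_comm]) (by
    simp only [Z, Matrix.transpose_smul, Matrix.transpose_add, Matrix.smul_mul, Matrix.mul_smul,
      Matrix.add_mul, Matrix.mul_add, hX, hX', ← smul_neg, neg_add])
  have hXYZ : ∀ a b, X a b = (1 / 2) * Y a b + (-Complex.I / 2) * Z a b := by
    intro a b
    simp only [Y, Z, Matrix.sub_apply, Matrix.smul_apply, Matrix.add_apply, smul_eq_mul]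
    linear_combination ((X a b + Xᴴ a b) / 2) * Complex.I_mul_I
  calc _ = (1 / 2) * ∑ a, (Y a i * τ a j k l + Y a j * τ i a k l + Y a k * τ i j a l
            + Y a l * τ i j k a)
        + (-Complex.I / 2) * ∑ a, (Z a i * τ a j k l + Z a j * τ i a k l + Z a k * τ i j a l
            + Z a l * τ i j k a) := by
        rw [Finset.mul_sum, Finset.mul_sum, ← Finset.sum_add_distrib]
        refine Finset.sum_congr rfl fun a _ => ?_
        rw [hXYZ a i, hXYZ a j, hXYZ a k, hXYZ a l]
        ring
    _ = 0 := by rw [hY, hZ]; simp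

lemma contraction_identity_four
    (τ : Fin N ⊕ Fin N → Fin N ⊕ Fin N → Fin N ⊕ Fin N → Fin N ⊕ Fin N → ℂ)
    (hτ : ∀ S : Matrix (Fin N ⊕ Fin N) (Fin N ⊕ Fin N) ℂ, IsCompactSymplectic S → ∀ i j k l,
      ∑ a, ∑ b, ∑ c, ∑ d, S a i * S b j * S c k * S d l * τ a b c d = τ i j k l)
    (p j k l : Fin N ⊕ Fin N) :
    (2 * (N : ℂ) + 1) * τ p j k l + τ j p k l + τ k j p l + τ l j k p =
      Imat N p j * ∑ i, ∑ q, Imat N i q * τ i q k l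
        + Imat N p k * ∑ i, ∑ q, Imat N i q * τ i j q l
        + Imat N p l * ∑ i, ∑ q, Imat N i q * τ i j k q := by
  have hlie : ∀ i q, Imat N q i * τ p j k l + Imat N p i * τ q j k l
      + (Imat N q j * τ i p k l + Imat N p j * τ i q k l)
      + (Imat N q k * τ i j p l + Imat N p k * τ i j q l)
      + (Imat N q l * τ i j k p + Imat N p l * τ i j k q) = 0 := by
    intro i q
    have h := lie_invariance_four τ hτ
      (Matrix.of fun a b => (if a = p then Imat N q b else 0) + if a = q then Imat N p b else 0)
      (by
        ext a b
        simp only [Matrix.mul_apply, Matrix.neg_apply, Matrix.transpose_apply, Matrix.of_apply,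
          add_mul, mul_add, Finset.sum_add_distrib, ite_mul, zero_mul, mul_ite, mul_zero,
          Finset.sum_ite_eq', Finset.mem_univ, if_true]
        rw [Imat_apply_swap N q a, Imat_apply_swap N p a]
        ring) i j k l
    simpa [add_mul, Finset.sum_add_distrib, ite_mul] using h
  have hsum : ∑ i, ∑ q, Imat N i q * (Imat N q i * τ p j k l + Imat N p i * τ q j k l
      + (Imat N q j * τ i p k l + Imat N p j * τ i q k l)
      + (Imat N q k * τ i j p l + Imat N p k * τ i j q l)
      + (Imat N q l * τ i j k p + Imat N p l * τ i j k q)) = 0 := by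
    simp [hlie]
  have hpull : ∀ (c : ℂ) (f : Fin N ⊕ Fin N → Fin N ⊕ Fin N → ℂ),
      ∑ i, ∑ q, Imat N i q * (c * f i q) = c * ∑ i, ∑ q, Imat N i q * f i q := by
    intro c f
    simp only [Finset.mul_sum]
    exact Finset.sum_congr rfl fun i _ => Finset.sum_congr rfl fun q _ => by ring
  have hfirst : ∑ i, ∑ q, Imat N i q * (Imat N q i * τ p j k l) = -(2 * (N : ℂ)) * τ p j k l := by
    rw [← sum_sum_Imat_mul_Imat]
    simp only [Finset.sum_mul, mul_assoc]
  simp only [mul_add, Finset.sum_add_distrib] at hsum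
  rw [hfirst, sum_sum_Imat_left N (fun q => τ q j k l) p,
    sum_sum_Imat_right N (fun i => τ i p k l) j, sum_sum_Imat_right N (fun i => τ i j p l) k,
    sum_sum_Imat_right N (fun i => τ i j k p) l, hpull, hpull, hpull] at hsum
  linear_combination -hsum

/-- The four-index relation determines the tensor. -/
lemma eq_zero_of_contraction_identity_four (hN : 2 ≤ N)
    (δ : Fin N ⊕ Fin N → Fin N ⊕ Fin N → Fin N ⊕ Fin N → Fin N ⊕ Fin N → ℂ)
    (hδ : ∀ p j k l, (2 * (N : ℂ) + 1) * δ p j k l + δ j p k l + δ k j p l + δ l j k p = 0)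
    (p j k l : Fin N ⊕ Fin N) : δ p j k l = 0 := by
  have : Nonempty (Fin N ⊕ Fin N) := ⟨p⟩
  obtain ⟨⟨a, b, c, d⟩, hmax⟩ := Finite.exists_max
    (fun x : (Fin N ⊕ Fin N) × (Fin N ⊕ Fin N) × (Fin N ⊕ Fin N) × (Fin N ⊕ Fin N) =>
      ‖δ x.1 x.2.1 x.2.2.1 x.2.2.2‖)
  have h : (2 * (N : ℂ) + 1) * δ a b c d = -(δ b a c d + δ c b a d + δ d b c a) := by
    linear_combination hδ a b c d
  have hnorm : (2 * (N : ℝ) + 1) * ‖δ a b c d‖ ≤ ‖δ a b c d‖ + ‖δ a b c d‖ + ‖δ a b c d‖ := by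
    have hc : ‖(2 * (N : ℂ) + 1)‖ = 2 * (N : ℝ) + 1 := by
      rw [show (2 * (N : ℂ) + 1) = ((2 * N + 1 : ℕ) : ℂ) by push_cast; ring, Complex.norm_natCast]
      push_cast; ring
    rw [← hc, ← norm_mul, h, norm_neg]
    refine (norm_add₃_le).trans ?_
    gcongr
    · exact hmax (b, a, c, d)
    · exact hmax (c, b, a, d)
    · exact hmax (d, b, c, a)
  have hN' : (2 : ℝ) ≤ N := by exact_mod_cast hN
  have h0 : ‖δ a b c d‖ ≤ 0 := by nlinarith [norm_nonneg (δ a b c d)]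
  exact norm_le_zero_iff.1 ((hmax (p, j, k, l)).trans h0)

/-- An invariant two-index tensor is a multiple of the symplectic form. -/
lemma two_tensor_eq (hN : 2 ≤ N) (q : Fin N ⊕ Fin N → Fin N ⊕ Fin N → ℂ)
    (hq : ∀ S : Matrix (Fin N ⊕ Fin N) (Fin N ⊕ Fin N) ℂ, IsCompactSymplectic S → ∀ i j,
      ∑ a, ∑ b, S a i * S b j * q a b = q i j) (i j : Fin N ⊕ Fin N) :
    2 * (N : ℂ) * q i j = Imat N i j * ∑ a, ∑ b, Imat N a b * q a b := by
  obtain ⟨k, l, hkl⟩ : ∃ k l, Imat N k l ≠ 0 :=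
    ⟨Sum.inr ⟨0, by omega⟩, Sum.inl ⟨0, by omega⟩, by simp [Imat]⟩
  have hτ : ∀ S : Matrix (Fin N ⊕ Fin N) (Fin N ⊕ Fin N) ℂ, IsCompactSymplectic S → ∀ i j k l,
      ∑ a, ∑ b, ∑ c, ∑ d, S a i * S b j * S c k * S d l * (q a b * Imat N c d)
        = q i j * Imat N k l := by
    intro S hS i j k l
    have hJ : ∑ c, ∑ d, S c k * S d l * Imat N c d = Imat N k l := by
      conv_rhs => rw [← hS.2]
      simp only [Matrix.mul_apply, Matrix.transpose_apply, Finset.sum_mul]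
      rw [Finset.sum_comm]
      exact Finset.sum_congr rfl fun c _ => Finset.sum_congr rfl fun d _ => by ring
    rw [← hq S hS i j, ← hJ, Finset.sum_mul]
    refine Finset.sum_congr rfl fun a _ => ?_
    rw [Finset.sum_mul]
    refine Finset.sum_congr rfl fun b _ => ?_
    rw [Finset.mul_sum]
    refine Finset.sum_congr rfl fun c _ => ?_
    rw [Finset.mul_sum]
    exact Finset.sum_congr rfl fun d _ => by ring
  have hrel : ∀ p j, (2 * (N : ℂ) + 1) * q p j + q j p
      = Imat N p j * ∑ a, ∑ b, Imat N a b * q a b := by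
    intro p j
    have h := contraction_identity_four (fun a b c d => q a b * Imat N c d) hτ p j k l
    have h1 : ∑ i, ∑ r, Imat N i r * (q i r * Imat N k l)
        = (∑ a, ∑ b, Imat N a b * q a b) * Imat N k l := by
      simp only [Finset.sum_mul, mul_assoc]
    have h2 : ∑ i, ∑ r, Imat N i r * (q i j * Imat N r l) = -q l j := by
      rw [← sum_sum_Imat_right N (fun i => q i j) l]
      exact Finset.sum_congr rfl fun i _ => Finset.sum_congr rfl fun r _ => by ring
    have h3 : ∑ i, ∑ r, Imat N i r * (q i j * Imat N k r) = q k j := by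
      rw [← neg_neg (q k j), ← sum_sum_Imat_right N (fun i => q i j) k]
      simp only [← Finset.sum_neg_distrib]
      exact Finset.sum_congr rfl fun i _ => Finset.sum_congr rfl fun r _ => by
        rw [Imat_apply_swap N k r]; ring
    simp only [h1, h2, h3] at h
    have hs := Imat_apply_swap N k p
    refine mul_right_cancel₀ hkl ?_
    linear_combination h - q l j * hs
  have hN0 : (N : ℂ) + 1 ≠ 0 := by exact_mod_cast Nat.succ_ne_zero N
  have e1 := hrel i j
  have e2 := hrel j i
  rw [Imat_apply_swap N j i] at e2
  have e3 : q i j + q j i = 0 := by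
    refine mul_left_cancel₀ (mul_ne_zero two_ne_zero hN0) ?_
    linear_combination e1 + e2
  linear_combination e1 - e3

end Lie

namespace IsCompactSymplectic

variable {N : ℕ} {S : Matrix (Fin N ⊕ Fin N) (Fin N ⊕ Fin N) ℂ}

lemma mul_conjTranspose (hS : IsCompactSymplectic S) : S * Sᴴ = 1 :=
  mul_eq_one_comm.1 hS.1

lemma transpose_mul_Imat (hS : IsCompactSymplectic S) : Sᵀ * Imat N = Imat N * Sᴴ := by
  conv_rhs => rw [← hS.2]
  rw [Matrix.mul_assoc _ S, hS.mul_conjTranspose, Matrix.mul_one]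

lemma conjTranspose_mul_Imat_mul (hS : IsCompactSymplectic S) :
    Sᴴ * Imat N * Sᵀᴴ = Imat N := by
  have h := congrArg Matrix.conjTranspose hS.2
  simpa [Matrix.conjTranspose_mul, Imat_conjTranspose, ← Matrix.mul_assoc] using h

lemma conjTranspose (hS : IsCompactSymplectic S) : IsCompactSymplectic Sᴴ := by
  refine ⟨by rw [Matrix.conjTranspose_conjTranspose, hS.mul_conjTranspose], ?_⟩
  have h : Sᵀᴴ * Imat N = Imat N * S := by
    have h := congrArg Matrix.conjTranspose hS.transpose_mul_Imat
    simp only [Matrix.conjTranspose_mul, Matrix.conjTranspose_conjTranspose, Imat_conjTranspose,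
      Matrix.neg_mul, Matrix.mul_neg, neg_inj] at h
    have h' := congrArg (fun M => Imat N * M * Imat N) h
    simp only [← Matrix.mul_assoc, Imat_mul_self] at h'
    simpa [Matrix.mul_assoc, Imat_mul_self] using h'
  rw [show Sᴴᵀ = Sᵀᴴ from rfl, h, Matrix.mul_assoc, hS.mul_conjTranspose, Matrix.mul_one]

end IsCompactSymplectic

section Conjugate

variable {N : ℕ}

/-- The bilinear form of the operator `U B U*` with respect to the symplectic form. -/
def conjugateForm (B U : Matrix (Fin N ⊕ Fin N) (Fin N ⊕ Fin N) ℂ) :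
    Matrix (Fin N ⊕ Fin N) (Fin N ⊕ Fin N) ℂ :=
  Imat N * (U * B * Uᴴ)

variable (B D : Matrix (Fin N ⊕ Fin N) (Fin N ⊕ Fin N) ℂ)
  {S U : Matrix (Fin N ⊕ Fin N) (Fin N ⊕ Fin N) ℂ}

lemma Imat_mul_conjugateForm : Imat N * conjugateForm B U = -(U * B * Uᴴ) := by
  rw [conjugateForm, ← Matrix.mul_assoc, Imat_mul_self, Matrix.neg_mul, Matrix.one_mul]

lemma transpose_mul_conjugateForm_mul (hS : IsCompactSymplectic S) :
    Sᵀ * conjugateForm B U * S = conjugateForm B (Sᴴ * U) := by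
  rw [conjugateForm, ← Matrix.mul_assoc, hS.transpose_mul_Imat]
  simp [conjugateForm, Matrix.mul_assoc]

lemma conjugateForm_mul_Imat_mul (hU : IsCompactSymplectic U) :
    conjugateForm D U * Imat N * conjugateForm B U = -conjugateForm (D * B) U := by
  rw [Matrix.mul_assoc, Imat_mul_conjugateForm, Matrix.mul_neg, conjugateForm, conjugateForm]
  have : U * D * Uᴴ * (U * B * Uᴴ) = U * (D * B) * Uᴴ := by
    calc _ = U * D * (Uᴴ * U) * B * Uᴴ := by simp only [Matrix.mul_assoc]
      _ = _ := by rw [hU.1]; simp only [Matrix.mul_assoc, Matrix.one_mul]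
  rw [Matrix.mul_assoc, this]

lemma conjugateForm_mul_Imat_mul_transpose (hU : IsCompactSymplectic U) :
    conjugateForm D U * Imat N * (conjugateForm B U)ᵀ
      = -conjugateForm (D * Imat N * Bᵀ * Imat N) U := by
  have h : (conjugateForm B U)ᵀ = -(Uᵀᴴ * Bᵀ * Imat N * Uᴴ) := by
    rw [conjugateForm, Matrix.transpose_mul, Imat_transpose, Matrix.transpose_mul,
      Matrix.transpose_mul, Matrix.mul_neg, Matrix.mul_assoc, Matrix.mul_assoc,
      hU.transpose_mul_Imat, show Uᴴᵀ = Uᵀᴴ from rfl]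
    simp only [Matrix.mul_assoc]
  rw [h, Matrix.mul_neg, conjugateForm, conjugateForm]
  congr 1
  calc _ = Imat N * U * D * (Uᴴ * Imat N * Uᵀᴴ) * Bᵀ * Imat N * Uᴴ := by
        simp only [Matrix.mul_assoc]
    _ = _ := by rw [hU.conjTranspose_mul_Imat_mul]; simp only [Matrix.mul_assoc]

lemma trace_Imat_mul_conjugateForm (hU : IsCompactSymplectic U) :
    (Imat N * conjugateForm B U).trace = -B.trace := by
  rw [Imat_mul_conjugateForm, Matrix.trace_neg, Matrix.trace_mul_comm, ← Matrix.mul_assoc, hU.1,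
    Matrix.one_mul]

lemma trace_eq_trace_conjugateForm (A C : Matrix (Fin N ⊕ Fin N) (Fin N ⊕ Fin N) ℂ) :
    (Uᴴ * A * U * B * Uᴴ * C * U * D).trace
      = (A * Imat N * conjugateForm B U * (C * Imat N) * conjugateForm D U).trace := by
  have h : A * Imat N * conjugateForm B U * (C * Imat N) * conjugateForm D U
      = A * (Imat N * conjugateForm B U) * (C * (Imat N * conjugateForm D U)) := by
    simp only [Matrix.mul_assoc]
  rw [h, Imat_mul_conjugateForm, Imat_mul_conjugateForm]
  simp only [Matrix.mul_neg, Matrix.neg_mul, neg_neg]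
  rw [show Uᴴ * A * U * B * Uᴴ * C * U * D = Uᴴ * (A * (U * B * Uᴴ) * (C * (U * D))) by
    simp only [Matrix.mul_assoc], Matrix.trace_mul_comm]
  simp only [Matrix.mul_assoc]

end Conjugate

section Sums

variable {ι : Type*} [Fintype ι]

lemma sum_sum_mul_sum_sum (f g : ι → ι → ℂ) :
    (∑ i, ∑ j, f i j) * (∑ k, ∑ l, g k l) = ∑ i, ∑ j, ∑ k, ∑ l, f i j * g k l := by
  rw [Finset.sum_mul]
  refine Finset.sum_congr rfl fun i _ => ?_
  rw [Finset.sum_mul]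
  refine Finset.sum_congr rfl fun j _ => ?_
  rw [Finset.mul_sum]
  exact Finset.sum_congr rfl fun k _ => Finset.mul_sum _ _ _

lemma trace_mul_mul_mul_eq_sum (M P K R : Matrix ι ι ℂ) :
    (M * P * K * R).trace = ∑ i, ∑ j, ∑ k, ∑ l, M i j * K k l * (P j k * R l i) := by
  simp only [Matrix.trace, Matrix.diag_apply, Matrix.mul_apply, Finset.sum_mul]
  refine Finset.sum_congr rfl fun i _ => ?_
  calc _ = ∑ l, ∑ j, ∑ k, M i j * P j k * K k l * R l i :=
        Finset.sum_congr rfl fun l _ => Finset.sum_comm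
    _ = ∑ j, ∑ l, ∑ k, M i j * P j k * K k l * R l i := Finset.sum_comm
    _ = ∑ j, ∑ k, ∑ l, M i j * P j k * K k l * R l i :=
        Finset.sum_congr rfl fun j _ => Finset.sum_comm
    _ = _ := Finset.sum_congr rfl fun j _ => Finset.sum_congr rfl fun k _ =>
        Finset.sum_congr rfl fun l _ => by ring

lemma mul_mul_apply_eq_sum (R J P : Matrix ι ι ℂ) (l k : ι) :
    (R * J * P) l k = ∑ i, ∑ q, J i q * (P q k * R l i) := by
  simp only [Matrix.mul_apply, Finset.sum_mul]
  rw [Finset.sum_comm]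
  exact Finset.sum_congr rfl fun i _ => Finset.sum_congr rfl fun q _ => by ring

lemma sum_pair_eq_trace_mul_trace (M K J : Matrix ι ι ℂ) :
    ∑ i, ∑ j, ∑ k, ∑ l, M i j * K k l * (J j i * J l k) = (M * J).trace * (K * J).trace := by
  simp only [Matrix.trace, Matrix.diag_apply, Matrix.mul_apply, sum_sum_mul_sum_sum]
  exact Finset.sum_congr rfl fun i _ => Finset.sum_congr rfl fun j _ =>
    Finset.sum_congr rfl fun k _ => Finset.sum_congr rfl fun l _ => by ring

lemma sum_crossed_eq_trace (M K J : Matrix ι ι ℂ) :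
    ∑ i, ∑ j, ∑ k, ∑ l, M i j * K k l * (J i k * J l j) = (Mᵀ * J * K * J).trace := by
  rw [trace_mul_mul_mul_eq_sum, Finset.sum_comm]
  rfl

end Sums

section Haar

variable {N : ℕ} {μ : Measure (Matrix (Fin N ⊕ Fin N) (Fin N ⊕ Fin N) ℂ)}

lemma memLp_top_mul_apply {F G : Matrix (Fin N ⊕ Fin N) (Fin N ⊕ Fin N) ℂ →
      Matrix (Fin N ⊕ Fin N) (Fin N ⊕ Fin N) ℂ}
    (hF : ∀ i j, MemLp (fun U => F U i j) ⊤ μ) (hG : ∀ i j, MemLp (fun U => G U i j) ⊤ μ)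
    (i j : Fin N ⊕ Fin N) : MemLp (fun U => (F U * G U) i j) ⊤ μ := by
  simp only [Matrix.mul_apply]
  exact memLp_finsetSum _ fun a _ => (hG a j).mul' (hF i a)

lemma measurable_matrix_apply (i j : Fin N ⊕ Fin N) :
    Measurable (fun U : Matrix (Fin N ⊕ Fin N) (Fin N ⊕ Fin N) ℂ => U i j) :=
  (measurable_pi_apply j).comp (measurable_pi_apply i)

lemma measurable_matrix_mul_left (S : Matrix (Fin N ⊕ Fin N) (Fin N ⊕ Fin N) ℂ) :
    Measurable (fun U : Matrix (Fin N ⊕ Fin N) (Fin N ⊕ Fin N) ℂ => S * U) := by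
  refine measurable_pi_iff.2 fun i => measurable_pi_iff.2 fun j => ?_
  simp only [Matrix.mul_apply]
  exact Finset.measurable_sum _ fun a _ => (measurable_matrix_apply a j).const_mul _

lemma sum_sum_mul_integral (c : Fin N ⊕ Fin N → Fin N ⊕ Fin N → ℂ)
    (f : Fin N ⊕ Fin N → Fin N ⊕ Fin N → Matrix (Fin N ⊕ Fin N) (Fin N ⊕ Fin N) ℂ → ℂ)
    (hf : ∀ i j, Integrable (f i j) μ) :
    ∑ i, ∑ j, c i j * ∫ U, f i j U ∂μ = ∫ U, ∑ i, ∑ j, c i j * f i j U ∂μ := by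
  rw [integral_finsetSum _ fun i _ => integrable_finsetSum _ fun j _ => (hf i j).const_mul _]
  refine Finset.sum_congr rfl fun i _ => ?_
  rw [integral_finsetSum _ fun j _ => (hf i j).const_mul _]
  exact Finset.sum_congr rfl fun j _ => (integral_const_mul _ _).symm

lemma sum_four_mul_integral
    (c : Fin N ⊕ Fin N → Fin N ⊕ Fin N → Fin N ⊕ Fin N → Fin N ⊕ Fin N → ℂ)
    (f : Fin N ⊕ Fin N → Fin N ⊕ Fin N → Fin N ⊕ Fin N → Fin N ⊕ Fin N →
      Matrix (Fin N ⊕ Fin N) (Fin N ⊕ Fin N) ℂ → ℂ)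
    (hf : ∀ i j k l, Integrable (f i j k l) μ) :
    ∑ i, ∑ j, ∑ k, ∑ l, c i j k l * ∫ U, f i j k l U ∂μ
      = ∫ U, ∑ i, ∑ j, ∑ k, ∑ l, c i j k l * f i j k l U ∂μ := by
  simp_rw [sum_sum_mul_integral _ _ (hf _ _)]
  have hint : ∀ i j, Integrable (fun U => ∑ k, ∑ l, c i j k l * f i j k l U) μ := fun i j =>
    integrable_finsetSum _ fun k _ => integrable_finsetSum _ fun l _ => (hf i j k l).const_mul _
  simpa using sum_sum_mul_integral (fun _ _ => 1) _ hint

lemma integral_comp_mul_left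
    (hinv : ∀ S : Matrix (Fin N ⊕ Fin N) (Fin N ⊕ Fin N) ℂ, IsCompactSymplectic S →
      μ.map (fun U => S * U) = μ)
    {S : Matrix (Fin N ⊕ Fin N) (Fin N ⊕ Fin N) ℂ} (hS : IsCompactSymplectic S)
    {g : Matrix (Fin N ⊕ Fin N) (Fin N ⊕ Fin N) ℂ → ℂ} (hg : Integrable g μ) :
    ∫ U, g (S * U) ∂μ = ∫ U, g U ∂μ := by
  conv_rhs => rw [← hinv S hS]
  refine (integral_map (measurable_matrix_mul_left S).aemeasurable ?_).symm
  rw [hinv S hS]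
  exact hg.aestronglyMeasurable

variable [IsProbabilityMeasure μ]

lemma memLp_top_conjugateForm (hmem : ∀ᵐ U ∂μ, IsCompactSymplectic U)
    (B : Matrix (Fin N ⊕ Fin N) (Fin N ⊕ Fin N) ℂ) (i j : Fin N ⊕ Fin N) :
    MemLp (fun U => conjugateForm B U i j) ⊤ μ := by
  have hU : ∀ i j, MemLp (fun U : Matrix (Fin N ⊕ Fin N) (Fin N ⊕ Fin N) ℂ => U i j) ⊤ μ := by
    intro i j
    refine memLp_top_of_bound (measurable_matrix_apply i j).aestronglyMeasurable 1 ?_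
    filter_upwards [hmem] with U hU
    exact entry_norm_bound_of_unitary (Matrix.mem_unitaryGroup_iff'.2 hU.1) i j
  have hUH : ∀ i j, MemLp (fun U : Matrix (Fin N ⊕ Fin N) (Fin N ⊕ Fin N) ℂ => Uᴴ i j) ⊤ μ :=
    fun i j => (hU j i).star
  have hc : ∀ (M : Matrix (Fin N ⊕ Fin N) (Fin N ⊕ Fin N) ℂ) (i j : Fin N ⊕ Fin N),
      MemLp (fun _ : Matrix (Fin N ⊕ Fin N) (Fin N ⊕ Fin N) ℂ => M i j) ⊤ μ :=
    fun M i j => memLp_const _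
  exact memLp_top_mul_apply (hc _)
    (memLp_top_mul_apply (memLp_top_mul_apply hU (hc B)) hUH) i j

lemma integrable_conjugateForm (hmem : ∀ᵐ U ∂μ, IsCompactSymplectic U)
    (B : Matrix (Fin N ⊕ Fin N) (Fin N ⊕ Fin N) ℂ) (i j : Fin N ⊕ Fin N) :
    Integrable (fun U => conjugateForm B U i j) μ :=
  (memLp_top_conjugateForm hmem B i j).integrable le_top

lemma integrable_conjugateForm_mul (hmem : ∀ᵐ U ∂μ, IsCompactSymplectic U)
    (B D : Matrix (Fin N ⊕ Fin N) (Fin N ⊕ Fin N) ℂ) (i j k l : Fin N ⊕ Fin N) :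
    Integrable (fun U => conjugateForm B U j k * conjugateForm D U l i) μ :=
  ((memLp_top_conjugateForm hmem D l i).mul' (r := ⊤)
    (memLp_top_conjugateForm hmem B j k)).integrable le_top

/-- The second moment of the compact symplectic group. -/
lemma integral_conjugateForm (hN : 2 ≤ N) (hmem : ∀ᵐ U ∂μ, IsCompactSymplectic U)
    (hinv : ∀ S : Matrix (Fin N ⊕ Fin N) (Fin N ⊕ Fin N) ℂ, IsCompactSymplectic S →
      μ.map (fun U => S * U) = μ)
    (B : Matrix (Fin N ⊕ Fin N) (Fin N ⊕ Fin N) ℂ) (j k : Fin N ⊕ Fin N) :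
    2 * (N : ℂ) * ∫ U, conjugateForm B U j k ∂μ = Imat N j k * B.trace := by
  have hint := integrable_conjugateForm hmem B
  rw [two_tensor_eq hN (fun j k => ∫ U, conjugateForm B U j k ∂μ)]
  · congr 1
    rw [sum_sum_mul_integral (fun a b => Imat N a b) (fun a b U => conjugateForm B U a b) hint]
    have : ∀ᵐ U ∂μ, ∑ a, ∑ b, Imat N a b * conjugateForm B U a b = B.trace := by
      filter_upwards [hmem] with U hU
      rw [← neg_neg B.trace, ← trace_Imat_mul_conjugateForm B hU]
      simp only [Matrix.trace, Matrix.diag_apply, Matrix.mul_apply, ← Finset.sum_neg_distrib]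
      rw [Finset.sum_comm]
      exact Finset.sum_congr rfl fun a _ => Finset.sum_congr rfl fun b _ => by
        rw [Imat_apply_swap N a b]; ring
    rw [integral_congr_ae this]
    simp
  · intro S hS i j
    rw [sum_sum_mul_integral (fun a b => S a i * S b j) (fun a b U => conjugateForm B U a b) hint,
      ← integral_comp_mul_left hinv hS.conjTranspose (hint i j)]
    congr 1
    ext U
    rw [← transpose_mul_conjugateForm_mul B hS]
    simp only [Matrix.mul_apply, Matrix.transpose_apply, Finset.sum_mul]
    rw [Finset.sum_comm]
    exact Finset.sum_congr rfl fun a _ => Finset.sum_congr rfl fun b _ => by ring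

lemma invariant_integral_conjugateForm_mul (hmem : ∀ᵐ U ∂μ, IsCompactSymplectic U)
    (hinv : ∀ S : Matrix (Fin N ⊕ Fin N) (Fin N ⊕ Fin N) ℂ, IsCompactSymplectic S →
      μ.map (fun U => S * U) = μ)
    (B D : Matrix (Fin N ⊕ Fin N) (Fin N ⊕ Fin N) ℂ)
    {S : Matrix (Fin N ⊕ Fin N) (Fin N ⊕ Fin N) ℂ} (hS : IsCompactSymplectic S)
    (i j k l : Fin N ⊕ Fin N) :
    ∑ a, ∑ b, ∑ c, ∑ d, S a i * S b j * S c k * S d l *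
        ∫ U, conjugateForm B U b c * conjugateForm D U d a ∂μ
      = ∫ U, conjugateForm B U j k * conjugateForm D U l i ∂μ := by
  have hint := integrable_conjugateForm_mul hmem B D
  rw [sum_four_mul_integral (fun a b c d => S a i * S b j * S c k * S d l)
      (fun a b c d U => conjugateForm B U b c * conjugateForm D U d a) hint,
    ← integral_comp_mul_left hinv hS.conjTranspose (hint i j k l)]
  congr 1
  ext U
  rw [← transpose_mul_conjugateForm_mul B hS, ← transpose_mul_conjugateForm_mul D hS]
  have happ : ∀ (M : Matrix (Fin N ⊕ Fin N) (Fin N ⊕ Fin N) ℂ) (x y : Fin N ⊕ Fin N),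
      (Sᵀ * M * S) x y = ∑ a, ∑ b, S a x * M a b * S b y := by
    intro M x y
    simp only [Matrix.mul_apply, Matrix.transpose_apply, Finset.sum_mul]
    exact Finset.sum_comm
  calc _ = ∑ b, ∑ c, ∑ d, ∑ a, S a i * S b j * S c k * S d l
          * (conjugateForm B U b c * conjugateForm D U d a) := by
        rw [Finset.sum_comm]
        refine Finset.sum_congr rfl fun b _ => ?_
        rw [Finset.sum_comm]
        exact Finset.sum_congr rfl fun c _ => Finset.sum_comm
    _ = _ := by
        rw [happ, happ, sum_sum_mul_sum_sum]
        exact Finset.sum_congr rfl fun b _ => Finset.sum_congr rfl fun c _ =>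
          Finset.sum_congr rfl fun d _ => Finset.sum_congr rfl fun a _ => by ring

/-- The fourth moment tensor satisfies a linear relation determining it. -/
lemma integral_conjugateForm_mul_relation (hN : 2 ≤ N) (hmem : ∀ᵐ U ∂μ, IsCompactSymplectic U)
    (hinv : ∀ S : Matrix (Fin N ⊕ Fin N) (Fin N ⊕ Fin N) ℂ, IsCompactSymplectic S →
      μ.map (fun U => S * U) = μ)
    (B D : Matrix (Fin N ⊕ Fin N) (Fin N ⊕ Fin N) ℂ)
    (τ : Fin N ⊕ Fin N → Fin N ⊕ Fin N → Fin N ⊕ Fin N → Fin N ⊕ Fin N → ℂ)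
    (hτ : ∀ i j k l, τ i j k l = ∫ U, conjugateForm B U j k * conjugateForm D U l i ∂μ)
    (p j k l : Fin N ⊕ Fin N) :
    2 * (N : ℂ) * ((2 * (N : ℂ) + 1) * τ p j k l + τ j p k l + τ k j p l + τ l j k p) =
      -(Imat N p j * Imat N l k * (D * B).trace
        + Imat N p k * Imat N l j * (D * Imat N * Bᵀ * Imat N).trace
        + Imat N p l * Imat N j k * (B.trace * D.trace)) := by
  have hint := integrable_conjugateForm_mul hmem B D
  have h := contraction_identity_four τ
    (fun S hS i j k l => by
      simp only [hτ]
      exact invariant_integral_conjugateForm_mul hmem hinv B D hS i j k l) p j k l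
  have h1 : ∑ i, ∑ q, Imat N i q * τ i q k l = -∫ U, conjugateForm (D * B) U l k ∂μ := by
    simp only [hτ]
    rw [sum_sum_mul_integral (fun i q => Imat N i q)
      (fun i q U => conjugateForm B U q k * conjugateForm D U l i) fun i q => hint i q k l,
      ← integral_neg]
    refine integral_congr_ae ?_
    filter_upwards [hmem] with U hU
    rw [← mul_mul_apply_eq_sum, conjugateForm_mul_Imat_mul B D hU, Matrix.neg_apply]
  have h2 : ∑ i, ∑ q, Imat N i q * τ i j q l
      = -∫ U, conjugateForm (D * Imat N * Bᵀ * Imat N) U l j ∂μ := by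
    simp only [hτ]
    rw [sum_sum_mul_integral (fun i q => Imat N i q)
      (fun i q U => conjugateForm B U j q * conjugateForm D U l i) fun i q => hint i j q l,
      ← integral_neg]
    refine integral_congr_ae ?_
    filter_upwards [hmem] with U hU
    rw [← Matrix.neg_apply, ← conjugateForm_mul_Imat_mul_transpose B D hU, mul_mul_apply_eq_sum]
    rfl
  have h3 : ∑ i, ∑ q, Imat N i q * τ i j k q = -D.trace * ∫ U, conjugateForm B U j k ∂μ := by
    simp only [hτ]
    rw [sum_sum_mul_integral (fun i q => Imat N i q)
      (fun i q U => conjugateForm B U j k * conjugateForm D U q i) fun i q => hint i j k q,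
      ← integral_const_mul]
    refine integral_congr_ae ?_
    filter_upwards [hmem] with U hU
    rw [← trace_Imat_mul_conjugateForm D hU]
    simp only [Matrix.trace, Matrix.diag_apply, Matrix.mul_apply, Finset.sum_mul]
    exact Finset.sum_congr rfl fun i _ => Finset.sum_congr rfl fun q _ => by ring
  rw [h1, h2, h3] at h
  have e1 := integral_conjugateForm hN hmem hinv (D * B) l k
  have e2 := integral_conjugateForm hN hmem hinv (D * Imat N * Bᵀ * Imat N) l j
  have e3 := integral_conjugateForm hN hmem hinv B j k
  linear_combination 2 * (N : ℂ) * h - Imat N p j * e1 - Imat N p k * e2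
    - Imat N p l * D.trace * e3

/-- The fourth moment tensor of the compact symplectic group. -/
lemma integral_conjugateForm_mul (hN : 2 ≤ N) (hmem : ∀ᵐ U ∂μ, IsCompactSymplectic U)
    (hinv : ∀ S : Matrix (Fin N ⊕ Fin N) (Fin N ⊕ Fin N) ℂ, IsCompactSymplectic S →
      μ.map (fun U => S * U) = μ)
    (B D : Matrix (Fin N ⊕ Fin N) (Fin N ⊕ Fin N) ℂ) (i j k l : Fin N ⊕ Fin N) :
    4 * (N : ℂ) * ((N : ℂ) - 1) * (2 * (N : ℂ) + 1) *
        ∫ U, conjugateForm B U j k * conjugateForm D U l i ∂μ =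
      ((2 * (N : ℂ) - 1) * (D * B).trace - (D * Imat N * Bᵀ * Imat N).trace
          - B.trace * D.trace) * (Imat N j i * Imat N l k)
        + (-(D * B).trace + (D * Imat N * Bᵀ * Imat N).trace
          + (2 * (N : ℂ) - 1) * (B.trace * D.trace)) * (Imat N j k * Imat N l i)
        - (-(D * B).trace + (2 * (N : ℂ) - 1) * (D * Imat N * Bᵀ * Imat N).trace
          + B.trace * D.trace) * (Imat N i k * Imat N l j) := by
  have hrel := integral_conjugateForm_mul_relation hN hmem hinv B D
    (fun i j k l => ∫ U, conjugateForm B U j k * conjugateForm D U l i ∂μ) fun _ _ _ _ => rfl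
  set b := (D * B).trace
  set s := (D * Imat N * Bᵀ * Imat N).trace
  set t := B.trace * D.trace
  rw [← sub_eq_zero]
  refine eq_zero_of_contraction_identity_four hN (fun i j k l =>
    4 * (N : ℂ) * ((N : ℂ) - 1) * (2 * (N : ℂ) + 1) *
        ∫ U, conjugateForm B U j k * conjugateForm D U l i ∂μ -
      (((2 * (N : ℂ) - 1) * b - s - t) * (Imat N j i * Imat N l k)
        + (-b + s + (2 * (N : ℂ) - 1) * t) * (Imat N j k * Imat N l i)
        - (-b + (2 * (N : ℂ) - 1) * s + t) * (Imat N i k * Imat N l j))) ?_ i j k l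
  intro p j k l
  have h := hrel p j k l
  beta_reduce at h ⊢
  rw [Imat_apply_swap N j p, Imat_apply_swap N k p, Imat_apply_swap N l p,
    Imat_apply_swap N j l]
  linear_combination (2 * ((N : ℂ) - 1) * (2 * (N : ℂ) + 1)) * h

end Haar

/-- For `N ≥ 2` and any `2N×2N` complex matrices `A, B, C, D`, the average over the compact
symplectic group `SP(2N)` with respect to normalized Haar measure satisfies the fourth-moment
formula of Lemma `lem-SPmoments`(ii). -/
theorem symplectic_fourth_moment (N : ℕ) (hN : 2 ≤ N)
    (A B C D : Matrix (Fin N ⊕ Fin N) (Fin N ⊕ Fin N) ℂ)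
    (μ : Measure (Matrix (Fin N ⊕ Fin N) (Fin N ⊕ Fin N) ℂ)) [IsProbabilityMeasure μ]
    (hmem : ∀ᵐ U ∂μ, Uᴴ * U = 1 ∧ Uᵀ * Imat N * U = Imat N)
    (hinv : ∀ S : Matrix (Fin N ⊕ Fin N) (Fin N ⊕ Fin N) ℂ,
      Sᴴ * S = 1 → Sᵀ * Imat N * S = Imat N → μ.map (fun U => S * U) = μ) :
    ∫ U, (Uᴴ * A * U * B * Uᴴ * C * U * D).trace ∂μ =
      (1 / (4 * (N : ℂ) * ((N : ℂ) - 1) * (2 * (N : ℂ) + 1))) *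
        ((2 * (N : ℂ) - 1) * (A.trace * C.trace * (B * D).trace)
          + A.trace * C.trace * ((Imat N)ᴴ * Bᵀ * Imat N * D).trace
          - A.trace * C.trace * B.trace * D.trace
          - ((Imat N)ᴴ * Aᵀ * Imat N * C).trace * (B * D).trace
          + ((Imat N)ᴴ * Aᵀ * Imat N * C).trace * B.trace * D.trace
          - (A * C).trace * (B * D).trace
          - (2 * (N : ℂ) - 1) *
              (((Imat N)ᴴ * Aᵀ * Imat N * C).trace * ((Imat N)ᴴ * Bᵀ * Imat N * D).trace)
          - (A * C).trace * ((Imat N)ᴴ * Bᵀ * Imat N * D).trace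
          + (2 * (N : ℂ) - 1) * ((A * C).trace * B.trace * D.trace)) := by
  have hmem' : ∀ᵐ U ∂μ, IsCompactSymplectic U := hmem
  have hinv' : ∀ S : Matrix (Fin N ⊕ Fin N) (Fin N ⊕ Fin N) ℂ, IsCompactSymplectic S →
      μ.map (fun U => S * U) = μ := fun S hS => hinv S hS.1 hS.2
  have hint := integrable_conjugateForm_mul hmem' B D
  have htr : ∫ U, (Uᴴ * A * U * B * Uᴴ * C * U * D).trace ∂μ
      = ∑ i, ∑ j, ∑ k, ∑ l, (A * Imat N) i j * (C * Imat N) k l *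
          ∫ U, conjugateForm B U j k * conjugateForm D U l i ∂μ := by
    rw [sum_four_mul_integral (fun i j k l => (A * Imat N) i j * (C * Imat N) k l)
      (fun i j k l U => conjugateForm B U j k * conjugateForm D U l i) hint]
    congr 1
    ext U
    rw [trace_eq_trace_conjugateForm, trace_mul_mul_mul_eq_sum]
  have h0 : (N : ℂ) ≠ 0 := by exact_mod_cast (by omega : N ≠ 0)
  have h1 : (N : ℂ) - 1 ≠ 0 := by
    rw [sub_ne_zero]; exact_mod_cast (by omega : N ≠ 1)
  have h2 : 2 * (N : ℂ) + 1 ≠ 0 := by exact_mod_cast (by omega : 2 * N + 1 ≠ 0)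
  have hΔ : 4 * (N : ℂ) * ((N : ℂ) - 1) * (2 * (N : ℂ) + 1) ≠ 0 :=
    mul_ne_zero (mul_ne_zero (mul_ne_zero (by norm_num) h0) h1) h2
  have hJJ : ∀ M : Matrix (Fin N ⊕ Fin N) (Fin N ⊕ Fin N) ℂ, M * Imat N * Imat N = -M := by
    intro M
    rw [Matrix.mul_assoc, Imat_mul_self, Matrix.mul_neg, Matrix.mul_one]
  have hsum1 := sum_pair_eq_trace_mul_trace (A * Imat N) (C * Imat N) (Imat N)
  rw [hJJ, hJJ, Matrix.trace_neg, Matrix.trace_neg, neg_mul_neg] at hsum1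
  have hsum2 := trace_mul_mul_mul_eq_sum (A * Imat N) (Imat N) (C * Imat N) (Imat N)
  rw [hJJ, ← Matrix.mul_assoc, hJJ, Matrix.neg_mul, neg_neg] at hsum2
  have hsum3 := sum_crossed_eq_trace (A * Imat N) (C * Imat N) (Imat N)
  rw [← Matrix.mul_assoc, hJJ, Matrix.transpose_mul, Imat_transpose, ← Imat_conjTranspose,
    Matrix.trace_neg] at hsum3
  have hBD : (D * B).trace = (B * D).trace := Matrix.trace_mul_comm _ _
  have hs : (D * Imat N * Bᵀ * Imat N).trace = -((Imat N)ᴴ * Bᵀ * Imat N * D).trace := by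
    rw [Imat_conjTranspose, Matrix.trace_mul_comm _ D]
    simp [Matrix.mul_assoc]
  rw [htr, one_div, eq_inv_mul_iff_mul_eq₀ hΔ]
  have hexp : ∀ i j k l, 4 * (N : ℂ) * ((N : ℂ) - 1) * (2 * (N : ℂ) + 1) *
      ((A * Imat N) i j * (C * Imat N) k l *
        ∫ U, conjugateForm B U j k * conjugateForm D U l i ∂μ) =
      ((2 * (N : ℂ) - 1) * (D * B).trace - (D * Imat N * Bᵀ * Imat N).trace
          - B.trace * D.trace) *
            ((A * Imat N) i j * (C * Imat N) k l * (Imat N j i * Imat N l k))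
        + (-(D * B).trace + (D * Imat N * Bᵀ * Imat N).trace
          + (2 * (N : ℂ) - 1) * (B.trace * D.trace)) *
            ((A * Imat N) i j * (C * Imat N) k l * (Imat N j k * Imat N l i))
        - (-(D * B).trace + (2 * (N : ℂ) - 1) * (D * Imat N * Bᵀ * Imat N).trace
          + B.trace * D.trace) *
            ((A * Imat N) i j * (C * Imat N) k l * (Imat N i k * Imat N l j)) := by
    intro i j k l
    linear_combination (A * Imat N) i j * (C * Imat N) k l *
      integral_conjugateForm_mul hN hmem' hinv' B D i j k l
  simp only [Finset.mul_sum, hexp]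
  simp only [Finset.sum_add_distrib, Finset.sum_sub_distrib, ← Finset.mul_sum]
  rw [hsum1, ← hsum2, hsum3, hBD, hs]
  ring
end
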